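/- arXiv:2501.18363 — 3 statements merged into one kernel-verified Lean document; each statement's English description precedes it below -/
import Mathlib

section
/- Consider the online uniform label noise model with noise rate ε ∈ (0,1) and target error rate α ∈ (0,1). Let η > 0 be a constant learning rate, let τ̂_1 ∈ [0,1] be a deterministic initial threshold, and update τ̂_{t+1} = τ̂_t − η·(1{S̃_t ≤ τ̂_t} − (1−α)) for t ≥ 1 (so τ̂_t is F_{t−1}-measurable). Then for every δ ∈ (0,1) and every integer T ≥ 1, with probability at least 1−δ: α − (1/T)·Σ_{t=1}^T 1{S_t > τ̂_t} ≤ A/√T + B/T + (ε/(1−ε))·(1/T)·Σ_{t=1}^T ( (1−α) − (1/K)·Σ_{y=1}^K P(S_{t,y} ≤ τ̂_t | F_{t−1}) ), where A = ((2−ε)/(1−ε))·√(2·log(4/δ)) and B = (1/(1−ε))·(1/η + 1). -/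
open MeasureTheory ProbabilityTheory

lemma aux_exp_le (s d : ℝ) (hd : |d| ≤ 1) :
    Real.exp (s * d) ≤ Real.cosh s + d * Real.sinh s := by
  obtain ⟨h1, h2⟩ := abs_le.mp hd
  have h := convexOn_exp.2 (Set.mem_univ s) (Set.mem_univ (-s))
    (show (0:ℝ) ≤ (1 + d) / 2 by linarith) (show (0:ℝ) ≤ (1 - d) / 2 by linarith) (by ring)
  simp only [smul_eq_mul] at h
  have e : (1 + d) / 2 * s + (1 - d) / 2 * -s = s * d := by ring
  rw [e] at h
  rw [Real.cosh_eq, Real.sinh_eq]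
  linarith

lemma aux_azuma {Ω : Type*} {m0 : MeasurableSpace Ω} (μ : Measure Ω) [IsProbabilityMeasure μ]
    (F : Filtration ℕ m0) (D : ℕ → Ω → ℝ)
    (hmeas : ∀ t, 1 ≤ t → Measurable[F t] (D t))
    (hb : ∀ t, 1 ≤ t → ∀ᵐ ω ∂μ, |D t ω| ≤ 1)
    (hmart : ∀ t, 1 ≤ t → ∀ Z : Ω → ℝ, Measurable[F (t - 1)] Z → Integrable Z μ →
      ∫ ω, Z ω * D t ω ∂μ = 0) (s : ℝ) (n : ℕ) :
    Measurable[F n] (fun ω => ∑ t ∈ Finset.Icc 1 n, D t ω) ∧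
    Integrable (fun ω => Real.exp (s * ∑ t ∈ Finset.Icc 1 n, D t ω)) μ ∧
    ∫ ω, Real.exp (s * ∑ t ∈ Finset.Icc 1 n, D t ω) ∂μ ≤ Real.exp (n * (s ^ 2 / 2)) := by
  induction n with
  | zero => simp
  | succ n ih =>
    obtain ⟨ihm, ihi, ihb⟩ := ih
    have hsum : ∀ ω, ∑ t ∈ Finset.Icc 1 (n + 1), D t ω
        = ∑ t ∈ Finset.Icc 1 n, D t ω + D (n + 1) ω := fun ω =>
      Finset.sum_Icc_succ_top (by omega) _
    simp only [hsum, mul_add, Real.exp_add]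
    have hD : Measurable (D (n + 1)) := (hmeas (n + 1) (by omega)).mono (F.le _) le_rfl
    have hDb := hb (n + 1) (by omega)
    have hM : Measurable[F n] (fun ω => Real.exp (s * ∑ t ∈ Finset.Icc 1 n, D t ω)) :=
      Real.measurable_exp.comp (ihm.const_mul s)
    have hi : Integrable (fun ω => Real.exp (s * ∑ t ∈ Finset.Icc 1 n, D t ω) *
        Real.exp (s * D (n + 1) ω)) μ := by
      refine ihi.mul_bdd (c := Real.exp |s|)
        (Real.measurable_exp.comp (hD.const_mul s)).aestronglyMeasurable ?_
      filter_upwards [hDb] with ω hω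
      rw [Real.norm_eq_abs, Real.abs_exp, Real.exp_le_exp]
      calc s * D (n + 1) ω ≤ |s * D (n + 1) ω| := le_abs_self _
        _ = |s| * |D (n + 1) ω| := abs_mul _ _
        _ ≤ |s| * 1 := by gcongr
        _ = |s| := mul_one _
    have hiD : Integrable (fun ω => Real.exp (s * ∑ t ∈ Finset.Icc 1 n, D t ω) *
        D (n + 1) ω) μ := ihi.mul_bdd (c := 1) hD.aestronglyMeasurable hDb
    refine ⟨(ihm.mono (F.mono (Nat.le_succ n)) le_rfl).add (hmeas (n + 1) (by omega)), hi, ?_⟩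
    calc ∫ ω, Real.exp (s * ∑ t ∈ Finset.Icc 1 n, D t ω) * Real.exp (s * D (n + 1) ω) ∂μ
        ≤ ∫ ω, (Real.cosh s * Real.exp (s * ∑ t ∈ Finset.Icc 1 n, D t ω)
            + Real.sinh s * (Real.exp (s * ∑ t ∈ Finset.Icc 1 n, D t ω) * D (n + 1) ω)) ∂μ := by
          refine integral_mono_ae hi ((ihi.const_mul _).add (hiD.const_mul _)) ?_
          filter_upwards [hDb] with ω hω
          have := mul_le_mul_of_nonneg_left (aux_exp_le s _ hω)
            (Real.exp_pos (s * ∑ t ∈ Finset.Icc 1 n, D t ω)).le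
          refine this.trans (le_of_eq ?_)
          ring
      _ = Real.cosh s * ∫ ω, Real.exp (s * ∑ t ∈ Finset.Icc 1 n, D t ω) ∂μ := by
          rw [integral_add (ihi.const_mul _) (hiD.const_mul _), integral_const_mul,
            integral_const_mul, hmart (n + 1) (by omega) _ hM ihi]
          ring
      _ ≤ Real.exp (s ^ 2 / 2) * Real.exp (n * (s ^ 2 / 2)) := by
          refine mul_le_mul (Real.cosh_le_exp_half_sq s) ihb
            (integral_nonneg fun _ => (Real.exp_pos _).le) (Real.exp_pos _).le
      _ = _ := by
          rw [← Real.exp_add]; congr 1; push_cast; ring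

lemma aux_indep {Ω : Type*} {m0 : MeasurableSpace Ω} (μ : Measure Ω) [IsProbabilityMeasure μ]
    {m1 m2 : MeasurableSpace Ω} (h1 : m1 ≤ m0) (h2 : m2 ≤ m0) (h : Indep m1 m2 μ)
    (A : Set Ω) (hA : MeasurableSet[m1] A) (W : Ω → ℝ) (hW : Measurable[m2] W) :
    ∫ ω, A.indicator (fun _ => (1:ℝ)) ω * W ω ∂μ = μ.real A * ∫ ω, W ω ∂μ := by
  have hAm : Measurable[m1] (A.indicator (fun _ => (1:ℝ))) := measurable_const.indicator hA
  have hi : IndepFun (A.indicator (fun _ => (1:ℝ))) W μ := by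
    rw [IndepFun_iff_Indep]
    exact indep_of_indep_of_le_left (indep_of_indep_of_le_right h hW.comap_le) hAm.comap_le
  have := hi.integral_mul_eq_mul_integral (hAm.mono h1 le_rfl).aestronglyMeasurable
    (hW.mono h2 le_rfl).aestronglyMeasurable
  simp only [Pi.mul_apply] at this
  rw [this, integral_indicator_const _ (h1 _ hA)]
  simp

lemma aux_meas_select {Ω : Type*} {m : MeasurableSpace Ω} {K : ℕ} {I : Fin K → Ω → ℝ}
    {Y : Ω → Fin K} (hI : ∀ y, Measurable (I y)) (hY : Measurable Y) :
    Measurable (fun ω => I (Y ω) ω) := by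
  have : Measurable (fun p : Fin K × Ω => I p.1 p.2) := measurable_from_prod_countable_right hI
  exact this.comp (hY.prodMk measurable_id)

/-- key orthogonality, single time step -/
lemma aux_mart {Ω : Type*} (m G : MeasurableSpace Ω) {m0 : MeasurableSpace Ω} (μ : Measure Ω)
    [IsProbabilityMeasure μ] (hm : m ≤ m0) (hG : G ≤ m0) (hmG : m ≤ G)
    (K : ℕ) (ε : ℝ) (hε : ε ∈ Set.Ioo (0:ℝ) 1)
    (I : Fin K → Ω → ℝ) (Y Ybar Ytil : Ω → Fin K) (U : Ω → ℝ)
    (hI : ∀ y, Measurable[G] (I y)) (hI01 : ∀ y ω, I y ω ∈ Set.Icc (0:ℝ) 1)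
    (hY : Measurable[G] Y) (hU : Measurable U) (hYbar : Measurable Ybar)
    (hU_unif : Measure.map U μ = volume.restrict (Set.Icc (0:ℝ) 1))
    (hYbar_unif : ∀ y : Fin K, μ {ω | Ybar ω = y} = (K : ENNReal)⁻¹)
    (hIndep : iIndep ![MeasurableSpace.comap U inferInstance,
          MeasurableSpace.comap Ybar inferInstance, G] μ)
    (hYtil : ∀ ω, Ytil ω = if ε ≤ U ω then Y ω else Ybar ω)
    (Z : Ω → ℝ) (hZ : Measurable[m] Z) (hZi : Integrable Z μ) :
    ∫ ω, Z ω * ((1 - ε) * I (Y ω) ω - I (Ytil ω) ω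
      + ε * ((1 / (K : ℝ)) * ∑ y : Fin K, (μ[I y | m]) ω)) ∂μ = 0 := by
  have hUle : MeasurableSpace.comap U inferInstance ≤ m0 := hU.comap_le
  have hYle : MeasurableSpace.comap Ybar inferInstance ≤ m0 := hYbar.comap_le
  have hle : ∀ i, (![MeasurableSpace.comap U inferInstance,
          MeasurableSpace.comap Ybar inferInstance, G] : Fin 3 → MeasurableSpace Ω) i ≤ m0 := by
    intro i
    fin_cases i
    · exact hUle
    · exact hYle
    · exact hG
  have hUG : Indep (MeasurableSpace.comap U inferInstance) G μ :=
    hIndep.indep (i := 0) (j := 2) (by decide)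
  have hUY : Indep (MeasurableSpace.comap U inferInstance)
      (MeasurableSpace.comap Ybar inferInstance) μ :=
    hIndep.indep (i := 0) (j := 1) (by decide)
  have hUYG : Indep (MeasurableSpace.comap U inferInstance ⊔
      MeasurableSpace.comap Ybar inferInstance) G μ := by
    have := indep_iSup_of_disjoint hle hIndep (S := {0, 1}) (T := {2}) (by simp)
    refine indep_of_indep_of_le_left (indep_of_indep_of_le_right this ?_) ?_
    · exact le_iSup₂_of_le (2 : Fin 3) (by simp) le_rfl
    · refine sup_le ?_ ?_
      · exact le_iSup₂_of_le (0 : Fin 3) (by simp) le_rfl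
      · exact le_iSup₂_of_le (1 : Fin 3) (by simp) le_rfl
  set A : Set Ω := {ω | ε ≤ U ω} with hAdef
  set B : Set Ω := {ω | U ω < ε} with hBdef
  have hAm : MeasurableSet[MeasurableSpace.comap U inferInstance] A := ⟨Set.Ici ε, measurableSet_Ici, rfl⟩
  have hBm : MeasurableSet[MeasurableSpace.comap U inferInstance] B := ⟨Set.Iio ε, measurableSet_Iio, rfl⟩
  have hCm : ∀ y, MeasurableSet[MeasurableSpace.comap Ybar inferInstance] {ω | Ybar ω = y} :=
    fun y => ⟨{y}, measurableSet_singleton y, rfl⟩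
  have hB : μ B = ENNReal.ofReal ε := by
    have : μ B = Measure.map U μ (Set.Iio ε) := (Measure.map_apply hU measurableSet_Iio).symm
    rw [this, hU_unif, Measure.restrict_apply measurableSet_Iio]
    have : Set.Iio ε ∩ Set.Icc (0:ℝ) 1 = Set.Ico 0 ε := by
      ext x; simp only [Set.mem_inter_iff, Set.mem_Iio, Set.mem_Icc, Set.mem_Ico]
      constructor
      · rintro ⟨h1, h2, h3⟩; exact ⟨h2, h1⟩
      · rintro ⟨h1, h2⟩; exact ⟨h2, h1, by linarith [hε.2]⟩
    rw [this]; simp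
  have hBr : μ.real B = ε := by
    rw [Measure.real, hB, ENNReal.toReal_ofReal hε.1.le]
  have hAr : μ.real A = 1 - ε := by
    have : A = Bᶜ := by ext ω; simp [hAdef, hBdef]
    rw [this, probReal_compl_eq_one_sub (hUle _ hBm), hBr]
  have hBC : ∀ y, μ.real (B ∩ {ω | Ybar ω = y}) = ε * (1 / (K : ℝ)) := by
    intro y
    have := (Indep_iff _ _ μ).1 hUY _ _ hBm (hCm y)
    rw [Measure.real, this, ENNReal.toReal_mul, hYbar_unif, ← Measure.real, hBr]
    simp
  have hZG : Measurable[G] Z := hZ.mono hmG le_rfl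
  have hIm : ∀ y, Measurable (I y) := fun y => (hI y).mono hG le_rfl
  have hIY : Measurable[G] (fun ω => I (Y ω) ω) := aux_meas_select (m := G) hI hY
  have hb : ∀ y ω, ‖I y ω‖ ≤ 1 := fun y ω => by
    rw [Real.norm_eq_abs, abs_le]; constructor <;> linarith [(hI01 y ω).1, (hI01 y ω).2]
  have hIint : ∀ y, Integrable (I y) μ := fun y =>
    Integrable.of_bound (hIm y).aestronglyMeasurable 1 (.of_forall (hb y))
  have hZI : ∀ y, Integrable (fun ω => Z ω * I y ω) μ := fun y =>
    hZi.mul_bdd (hIm y).aestronglyMeasurable (.of_forall (hb y))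
  have hZY : Integrable (fun ω => Z ω * I (Y ω) ω) μ :=
    hZi.mul_bdd (hIY.mono hG le_rfl).aestronglyMeasurable (.of_forall (fun ω => hb _ ω))
  have hZsm : StronglyMeasurable[m] Z := hZ.stronglyMeasurable
  have hq : ∀ y, Integrable (fun ω => Z ω * (μ[I y | m]) ω) μ ∧
      ∫ ω, Z ω * (μ[I y | m]) ω ∂μ = ∫ ω, Z ω * I y ω ∂μ := by
    intro y
    have h := condExp_mul_of_stronglyMeasurable_left (μ := μ) hZsm (hZI y) (hIint y)
    refine ⟨(integrable_condExp (μ := μ) (m := m)).congr h, ?_⟩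
    rw [← integral_condExp hm (f := fun ω => Z ω * I y ω)]
    exact (integral_congr_ae h).symm
  have hind : ∀ (C : Set Ω) (W : Ω → ℝ), MeasurableSet C → Integrable W μ →
      Integrable (fun ω => C.indicator (fun _ => (1:ℝ)) ω * W ω) μ := by
    intro C W hC hW
    refine hW.bdd_mul (c := 1) (measurable_const.indicator hC).aestronglyMeasurable
      (.of_forall fun ω => ?_)
    by_cases h : ω ∈ C <;> simp [h]
  have hCint : ∀ y, Integrable (fun ω => (B ∩ {ω | Ybar ω = y}).indicator (fun _ => (1:ℝ)) ω
      * (Z ω * I y ω)) μ := fun y =>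
    hind _ _ ((hUle _ hBm).inter (hYle _ (hCm y))) (hZI y)
  have hAint := hind A _ (hUle _ hAm) hZY
  have hpt : ∀ ω, Z ω * ((1 - ε) * I (Y ω) ω - I (Ytil ω) ω
      + ε * ((1 / (K : ℝ)) * ∑ y : Fin K, (μ[I y | m]) ω))
      = ((1 - ε) * (Z ω * I (Y ω) ω) - A.indicator (fun _ => (1:ℝ)) ω * (Z ω * I (Y ω) ω))
        + ∑ y : Fin K, (ε * (1 / (K : ℝ)) * (Z ω * (μ[I y | m]) ω)
          - (B ∩ {ω | Ybar ω = y}).indicator (fun _ => (1:ℝ)) ω * (Z ω * I y ω)) := by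
    intro ω
    have key : Z ω * I (Ytil ω) ω = A.indicator (fun _ => (1:ℝ)) ω * (Z ω * I (Y ω) ω)
        + ∑ y : Fin K, (B ∩ {ω | Ybar ω = y}).indicator (fun _ => (1:ℝ)) ω * (Z ω * I y ω) := by
      rw [hYtil]
      by_cases h : ε ≤ U ω
      · have h' : ¬ U ω < ε := not_lt.mpr h
        simp [hAdef, hBdef, h, h', Set.indicator]
      · have h' : U ω < ε := not_le.mp h
        simp [hAdef, hBdef, h, h', Set.indicator]
    rw [Finset.sum_sub_distrib, ← Finset.mul_sum, ← Finset.mul_sum]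
    linear_combination - key
  simp_rw [hpt]
  rw [integral_add, integral_sub, integral_finsetSum, integral_const_mul,
    aux_indep μ hUle hG hUG A hAm (fun ω => Z ω * I (Y ω) ω) (hZG.mul hIY), hAr]
  · have : ∀ y ∈ (Finset.univ : Finset (Fin K)),
        ∫ ω, (ε * (1 / (K : ℝ)) * (Z ω * (μ[I y | m]) ω)
          - (B ∩ {ω | Ybar ω = y}).indicator (fun _ => (1:ℝ)) ω * (Z ω * I y ω)) ∂μ = 0 := by
      intro y _
      rw [integral_sub ((hq y).1.const_mul _) (hCint y), integral_const_mul, (hq y).2,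
        aux_indep μ (sup_le hUle hYle) hG hUYG (B ∩ {ω | Ybar ω = y}) ?_
          (fun ω => Z ω * I y ω) (hZG.mul (hI y)), hBC]
      · simp
      · exact MeasurableSet.inter (le_sup_left (a := MeasurableSpace.comap U inferInstance) _ hBm)
          (le_sup_right (a := MeasurableSpace.comap U inferInstance) _ (hCm y))
    rw [Finset.sum_eq_zero this]
    simp
  · exact fun y _ => ((hq y).1.const_mul _).sub (hCint y)
  · exact hZY.const_mul _
  · exact hAint
  · exact (hZY.const_mul _).sub hAint
  · exact integrable_finsetSum _ fun y _ => ((hq y).1.const_mul _).sub (hCint y)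

/-- coverage gap of standard ACI (online conformal prediction with pinball
gradient updates computed from noisy labels) under online uniform label noise with noise
rate `ε`, constant learning rate `η`, target error rate `α`. -/
theorem aci_coverage_gap_under_label_noise
    {Ω : Type*} {m0 : MeasurableSpace Ω} (μ : Measure Ω) [IsProbabilityMeasure μ]
    (F : Filtration ℕ m0)
    (K : ℕ) (hK : 1 ≤ K) (ε α : ℝ) (hε : ε ∈ Set.Ioo (0:ℝ) 1) (hα : α ∈ Set.Ioo (0:ℝ) 1)
    (S : ℕ → Fin K → Ω → ℝ) (Y : ℕ → Ω → Fin K) (U : ℕ → Ω → ℝ) (Ybar : ℕ → Ω → Fin K)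
    -- measurability of the scores and labels with respect to the filtration
    (hS_meas : ∀ t, 1 ≤ t → ∀ y, Measurable[F t] (S t y))
    (hS_range : ∀ t, 1 ≤ t → ∀ y ω, S t y ω ∈ Set.Icc (0:ℝ) 1)
    (hY_meas : ∀ t, 1 ≤ t → Measurable[F t] (Y t))
    (hU_meas : ∀ t, 1 ≤ t → Measurable[F t] (U t))
    (hYbar_meas : ∀ t, 1 ≤ t → Measurable[F t] (Ybar t))
    -- U_t is uniformly distributed on [0,1], Ȳ_t uniformly on {1,…,K}
    (hU_unif : ∀ t, 1 ≤ t → Measure.map (U t) μ = volume.restrict (Set.Icc (0:ℝ) 1))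
    (hYbar_unif : ∀ t, 1 ≤ t → ∀ y : Fin K, μ {ω | Ybar t ω = y} = (K : ENNReal)⁻¹)
    -- U_t, Ȳ_t and the σ-algebra generated by F_{t-1} together with (Y_t, S_{t,·})
    -- are mutually independent
    (hIndep : ∀ t, 1 ≤ t →
      iIndep
        ![MeasurableSpace.comap (U t) inferInstance,
          MeasurableSpace.comap (Ybar t) inferInstance,
          (F (t - 1) : MeasurableSpace Ω) ⊔
            MeasurableSpace.comap (fun ω => (Y t ω, fun y => S t y ω)) inferInstance] μ)
    -- the noisy labels
    (Ytil : ℕ → Ω → Fin K)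
    (hYtil : ∀ t, 1 ≤ t → ∀ ω, Ytil t ω = if ε ≤ U t ω then Y t ω else Ybar t ω)
    -- constant learning rate and deterministic initial threshold
    (η : ℝ) (hη : 0 < η) (τ0 : ℝ) (hτ0 : τ0 ∈ Set.Icc (0:ℝ) 1)
    (τ : ℕ → Ω → ℝ) (hτ1 : ∀ ω, τ 1 ω = τ0)
    -- ACI update using the noisy score S̃_t = S_{t, Ỹ_t}
    (hupd : ∀ t, 1 ≤ t → ∀ ω,
      τ (t + 1) ω = τ t ω - η * ((if S t (Ytil t ω) ω ≤ τ t ω then (1:ℝ) else 0) - (1 - α)))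
    (δ : ℝ) (hδ : δ ∈ Set.Ioo (0:ℝ) 1) (T : ℕ) (hT : 1 ≤ T) :
    ENNReal.ofReal (1 - δ) ≤
      μ {ω |
        α - (1 / (T : ℝ)) * ∑ t ∈ Finset.Icc 1 T,
              (if τ t ω < S t (Y t ω) ω then (1:ℝ) else 0)
          ≤ ((2 - ε) / (1 - ε)) * Real.sqrt (2 * Real.log (4 / δ)) / Real.sqrt T
            + (1 / (1 - ε)) * (1 / η + 1) / T
            + (ε / (1 - ε)) * ((1 / (T : ℝ)) * ∑ t ∈ Finset.Icc 1 T,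
                ((1 - α) - (1 / (K : ℝ)) * ∑ y : Fin K,
                  (μ[fun ω' => if S t y ω' ≤ τ t ω' then (1:ℝ) else 0 | F (t - 1)]) ω))} := by
  have hε0 : 0 < ε := hε.1
  have hε1 : 0 < 1 - ε := by linarith [hε.2]
  have hα0 := hα.1
  have hα1 := hα.2
  have hKpos : (0:ℝ) < K := by exact_mod_cast hK
  have hTpos : (0:ℝ) < T := by exact_mod_cast hT
  -- measurability
  have hYtil_meas : ∀ t, 1 ≤ t → Measurable[F t] (Ytil t) := by
    intro t ht
    have : Ytil t = fun ω => if ε ≤ U t ω then Y t ω else Ybar t ω := funext (hYtil t ht)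
    rw [this]
    exact Measurable.ite (measurableSet_le (@measurable_const _ _ _ (F t) _) (hU_meas t ht)) (hY_meas t ht) (hYbar_meas t ht)
  have hτ_meas : ∀ t, Measurable[F t] (τ (t + 1)) := by
    intro t
    induction t with
    | zero =>
      have : τ (0 + 1) = fun _ => τ0 := funext hτ1
      rw [this]; exact measurable_const
    | succ n ih =>
      have : τ (n + 1 + 1) = fun ω => τ (n + 1) ω - η *
          ((if S (n + 1) (Ytil (n + 1) ω) ω ≤ τ (n + 1) ω then (1:ℝ) else 0) - (1 - α)) :=
        funext (hupd (n + 1) (by omega))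
      rw [this]
      have h1 : Measurable[F (n + 1)] (τ (n + 1)) := ih.mono (F.mono (Nat.le_succ n)) le_rfl
      have h2 : Measurable[F (n + 1)] (fun ω => S (n + 1) (Ytil (n + 1) ω) ω) :=
        aux_meas_select (m := F (n + 1)) (hS_meas _ (by omega)) (hYtil_meas _ (by omega))
      have h3 : Measurable[F (n + 1)] (fun ω =>
          if S (n + 1) (Ytil (n + 1) ω) ω ≤ τ (n + 1) ω then (1:ℝ) else 0) :=
        Measurable.ite (measurableSet_le h2 h1) measurable_const measurable_const
      exact h1.sub ((h3.sub_const _).const_mul _)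
  have hτ_meas' : ∀ t, 1 ≤ t → Measurable[F (t - 1)] (τ t) := by
    intro t ht
    obtain ⟨n, rfl⟩ : ∃ n, t = n + 1 := ⟨t - 1, by omega⟩
    exact hτ_meas n
  set I : ℕ → Fin K → Ω → ℝ := fun t y ω => if S t y ω ≤ τ t ω then (1:ℝ) else 0 with hI
  have hI01 : ∀ t y ω, I t y ω ∈ Set.Icc (0:ℝ) 1 := by
    intro t y ω
    simp only [hI]
    split_ifs <;> simp
  have hImeas : ∀ t, 1 ≤ t → ∀ y, Measurable[F t] (I t y) := by
    intro t ht y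
    exact Measurable.ite (measurableSet_le (hS_meas t ht y)
      ((hτ_meas' t ht).mono (F.mono (Nat.sub_le t 1)) le_rfl)) measurable_const measurable_const
  set D : ℕ → Ω → ℝ := fun t ω => (1 - ε) * I t (Y t ω) ω - I t (Ytil t ω) ω
      + ε * ((1 / (K : ℝ)) * ∑ y : Fin K, (μ[I t y | F (t - 1)]) ω) with hD
  have hDmeas : ∀ t, 1 ≤ t → Measurable[F t] (D t) := by
    intro t ht
    have h1 : Measurable[F t] (fun ω => I t (Y t ω) ω) :=
      aux_meas_select (m := F t) (hImeas t ht) (hY_meas t ht)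
    have h2 : Measurable[F t] (fun ω => I t (Ytil t ω) ω) :=
      aux_meas_select (m := F t) (hImeas t ht) (hYtil_meas t ht)
    have h3 : Measurable[F t] (fun ω => ∑ y : Fin K, (μ[I t y | F (t - 1)]) ω) := by
      refine Finset.measurable_fun_sum _ fun y _ => ?_
      exact stronglyMeasurable_condExp.measurable.mono (F.mono (Nat.sub_le t 1)) le_rfl
    exact ((h1.const_mul _).sub h2).add ((h3.const_mul _).const_mul _)
  have hDb : ∀ t, 1 ≤ t → ∀ᵐ ω ∂μ, |D t ω| ≤ 1 := by
    intro t ht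
    have hIntg : ∀ y, Integrable (I t y) μ := fun y => by
      refine Integrable.of_bound ((hImeas t ht y).mono (F.le t) le_rfl).aestronglyMeasurable 1
        (.of_forall fun ω => ?_)
      rw [Real.norm_eq_abs, abs_le]
      constructor <;> linarith [(hI01 t y ω).1, (hI01 t y ω).2]
    have h0 : ∀ᵐ ω ∂μ, ∀ y, 0 ≤ (μ[I t y | F (t - 1)]) ω := by
      rw [ae_all_iff]; intro y
      exact condExp_nonneg (.of_forall fun ω => (hI01 t y ω).1)
    have h1 : ∀ᵐ ω ∂μ, ∀ y, (μ[I t y | F (t - 1)]) ω ≤ 1 := by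
      rw [ae_all_iff]; intro y
      have := condExp_mono (m := F (t - 1)) (hIntg y) (integrable_const (1:ℝ))
        (.of_forall fun ω => (hI01 t y ω).2)
      rwa [condExp_const (F.le _)] at this
    filter_upwards [h0, h1] with ω h0 h1
    have q0 : 0 ≤ (1 / (K : ℝ)) * ∑ y : Fin K, (μ[I t y | F (t - 1)]) ω :=
      mul_nonneg (by positivity) (Finset.sum_nonneg fun y _ => h0 y)
    have q1 : (1 / (K : ℝ)) * ∑ y : Fin K, (μ[I t y | F (t - 1)]) ω ≤ 1 := by
      have : ∑ y : Fin K, (μ[I t y | F (t - 1)]) ω ≤ ∑ y : Fin K, (1:ℝ) :=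
        Finset.sum_le_sum fun y _ => h1 y
      simp only [Finset.sum_const, Finset.card_univ, Fintype.card_fin, nsmul_eq_mul,
        mul_one] at this
      rw [one_div, inv_mul_le_iff₀ hKpos]; linarith
    have a := hI01 t (Y t ω) ω
    have b := hI01 t (Ytil t ω) ω
    simp only [hD]
    rw [abs_le]
    have e1 := mul_nonneg hε1.le a.1
    have e2 := mul_le_mul_of_nonneg_left a.2 hε1.le
    have e3 := mul_nonneg hε0.le q0
    have e4 := mul_le_mul_of_nonneg_left q1 hε0.le
    constructor <;> linarith [b.1, b.2]
  have hmart : ∀ t, 1 ≤ t → ∀ Z : Ω → ℝ, Measurable[F (t - 1)] Z → Integrable Z μ →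
      ∫ ω, Z ω * D t ω ∂μ = 0 := by
    intro t ht Z hZ hZi
    have hpair : Measurable[F t] (fun ω => (Y t ω, fun y => S t y ω)) :=
      (hY_meas t ht).prodMk (@measurable_pi_lambda _ _ _ (F t) _ _ (hS_meas t ht))
    set G : MeasurableSpace Ω := (F (t - 1) : MeasurableSpace Ω) ⊔
      MeasurableSpace.comap (fun ω => (Y t ω, fun y => S t y ω)) inferInstance with hGdef
    have hpG : Measurable[G] (fun ω => (Y t ω, fun y => S t y ω)) :=
      (comap_measurable _).mono le_sup_right le_rfl
    have hG : G ≤ m0 := sup_le (F.le _) (hpair.comap_le.trans (F.le _))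
    refine aux_mart (F (t - 1)) G μ (F.le _) hG le_sup_left K ε hε (I t) (Y t) (Ybar t) (Ytil t)
      (U t) ?_ (hI01 t) (measurable_fst.comp hpG) ((hU_meas t ht).mono (F.le t) le_rfl)
      ((hYbar_meas t ht).mono (F.le t) le_rfl) (hU_unif t ht) (hYbar_unif t ht) (hIndep t ht)
      (hYtil t ht) Z hZ hZi
    intro y
    have hSy : Measurable[G] (S t y) := (measurable_pi_apply y).comp (measurable_snd.comp hpG)
    exact Measurable.ite (measurableSet_le hSy
      ((hτ_meas' t ht).mono le_sup_left le_rfl)) measurable_const measurable_const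
  -- threshold bound
  have hlow : ∀ ω n, -η ≤ τ (n + 1) ω := by
    intro ω n
    induction n with
    | zero => rw [zero_add, hτ1]; linarith [hτ0.1]
    | succ n ih =>
      rw [hupd (n + 1) (by omega)]
      have hr := (hS_range (n + 1) (by omega) (Ytil (n + 1) ω) ω).1
      split_ifs with h
      · have : η * (1 - (1 - α)) ≤ η * 1 := by gcongr; linarith
        linarith
      · have : 0 ≤ η * (1 - α) := mul_nonneg hη.le (by linarith)
        linarith
  have htel : ∀ ω n, η * ∑ t ∈ Finset.Icc 1 n, (I t (Ytil t ω) ω - (1 - α))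
      = τ0 - τ (n + 1) ω := by
    intro ω n
    induction n with
    | zero => simp [hτ1]
    | succ n ih =>
      rw [Finset.sum_Icc_succ_top (by omega), mul_add, ih, hupd (n + 1) (by omega)]
      ring
  have hctil : ∀ ω, ∑ t ∈ Finset.Icc 1 T, (I t (Ytil t ω) ω - (1 - α)) ≤ 1 / η + 1 := by
    intro ω
    have h := htel ω T
    have h2 := hlow ω T
    have h3 : η * ∑ t ∈ Finset.Icc 1 T, (I t (Ytil t ω) ω - (1 - α)) ≤ η * (1 / η + 1) := by
      have : η * (1 / η + 1) = 1 + η := by field_simp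
      rw [this, h]; linarith [hτ0.2]
    exact le_of_mul_le_mul_left h3 hη
  -- concentration
  set L := Real.log (4 / δ) with hL
  have hδ0 := hδ.1
  have hLpos : 0 < L := Real.log_pos (by rw [lt_div_iff₀ hδ0]; linarith [hδ.2])
  set x := Real.sqrt (2 * L) * Real.sqrt T with hx
  have hx0 : 0 ≤ x := by positivity
  have hx2 : x ^ 2 = 2 * L * T := by
    rw [hx, mul_pow, Real.sq_sqrt (by positivity), Real.sq_sqrt hTpos.le]
  obtain ⟨hMm, hMi, hMb⟩ := aux_azuma μ F D hDmeas hDb hmart (x / T) T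
  have hMm0 := hMm.mono (F.le T) le_rfl
  have htail : μ.real {ω | x ≤ ∑ t ∈ Finset.Icc 1 T, D t ω} ≤ δ := by
    have h := measure_ge_le_exp_mul_mgf (X := fun ω => ∑ t ∈ Finset.Icc 1 T, D t ω)
      (μ := μ) (t := x / T) x (by positivity) hMi
    refine h.trans ?_
    calc _ ≤ Real.exp (-(x / T) * x) * Real.exp (T * ((x / T) ^ 2 / 2)) := by
          gcongr; exact hMb
      _ = Real.exp (-L) := by
          rw [← Real.exp_add]; congr 1
          field_simp
          linarith [hx2]
      _ = δ / 4 := by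
          rw [Real.exp_neg, hL, Real.exp_log (by positivity), inv_div]
      _ ≤ δ := by linarith
  have hgood : ENNReal.ofReal (1 - δ) ≤ μ {ω | ∑ t ∈ Finset.Icc 1 T, D t ω < x} := by
    have hc : {ω | ∑ t ∈ Finset.Icc 1 T, D t ω < x}
        = {ω | x ≤ ∑ t ∈ Finset.Icc 1 T, D t ω}ᶜ := by ext ω; simp
    rw [ENNReal.ofReal_le_iff_le_toReal (measure_ne_top _ _), ← Measure.real, hc,
      probReal_compl_eq_one_sub (measurableSet_le measurable_const hMm0)]
    linarith
  refine hgood.trans (measure_mono fun ω hω => ?_)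
  simp only [Set.mem_ofPred_eq] at hω ⊢
  set Q := ∑ t ∈ Finset.Icc 1 T, ((1 - α) - (1 / (K : ℝ)) * ∑ y : Fin K,
    (μ[I t y | F (t - 1)]) ω) with hQ
  have hneg : ∑ t ∈ Finset.Icc 1 T, (if τ t ω < S t (Y t ω) ω then (1:ℝ) else 0)
      = T - ∑ t ∈ Finset.Icc 1 T, I t (Y t ω) ω := by
    rw [eq_sub_iff_add_eq, ← Finset.sum_add_distrib]
    have : ∀ t ∈ Finset.Icc 1 T, (if τ t ω < S t (Y t ω) ω then (1:ℝ) else 0)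
        + I t (Y t ω) ω = 1 := by
      intro t _
      simp only [hI]
      by_cases h : S t (Y t ω) ω ≤ τ t ω
      · simp [h, not_lt.mpr h]
      · simp [h, not_le.mp h]
    rw [Finset.sum_congr rfl this]; simp
  have hdec : (1 - ε) * (∑ t ∈ Finset.Icc 1 T, I t (Y t ω) ω - T * (1 - α))
      = ∑ t ∈ Finset.Icc 1 T, D t ω + ∑ t ∈ Finset.Icc 1 T, (I t (Ytil t ω) ω - (1 - α))
        + ε * Q := by
    have : (T:ℝ) * (1 - α) = ∑ t ∈ Finset.Icc 1 T, (1 - α) := by simp [mul_sub]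
    rw [this, hQ, ← Finset.sum_sub_distrib, Finset.mul_sum, Finset.mul_sum,
      ← Finset.sum_add_distrib, ← Finset.sum_add_distrib]
    refine Finset.sum_congr rfl fun t _ => ?_
    simp only [hD]
    ring
  rw [hneg]
  have hxle : x ≤ (2 - ε) * x := by
    have : 0 ≤ (1 - ε) * x := mul_nonneg hε1.le hx0
    linarith
  have hsT : Real.sqrt T * Real.sqrt T = T := Real.mul_self_sqrt hTpos.le
  have hsTpos : 0 < Real.sqrt T := Real.sqrt_pos.mpr hTpos
  have hlhs : α - 1 / (T:ℝ) * (T - ∑ t ∈ Finset.Icc 1 T, I t (Y t ω) ω)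
      = (1 - ε) * (∑ t ∈ Finset.Icc 1 T, I t (Y t ω) ω - T * (1 - α)) / ((1 - ε) * T) := by
    field_simp
    ring
  have hrhs : (2 - ε) / (1 - ε) * Real.sqrt (2 * L) / Real.sqrt T
      + 1 / (1 - ε) * (1 / η + 1) / T + ε / (1 - ε) * (1 / (T:ℝ) * Q)
      = ((2 - ε) * x + (1 / η + 1) + ε * Q) / ((1 - ε) * T) := by
    have : (2 - ε) / (1 - ε) * Real.sqrt (2 * L) / Real.sqrt T
        = (2 - ε) * x / ((1 - ε) * T) := by
      rw [hx, div_eq_div_iff hsTpos.ne' (by positivity)]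
      field_simp
      linear_combination (-(2 - ε)) * hsT
    rw [this]
    field_simp
  rw [hlhs, hdec]
  refine le_of_le_of_eq ?_ hrhs.symm
  have := hctil ω
  gcongr
  linarith
end

section
/- Consider the online uniform label noise model with noise rate ε ∈ (0,1) and α ∈ (0,1). Let η > 0 be a constant learning rate, τ̂_1 ∈ [0,1] a deterministic initial threshold, and update τ̂_{t+1} = τ̂_t − η·g̃(τ̂_t, S̃_t, (S_{t,y})_{y=1}^K). Then for every δ ∈ (0,1) and integer T ≥ 1, with probability at least 1−δ, the expected coverage error satisfies | (1/T)·Σ_{t=1}^T P(S_t > τ̂_t | F_{t−1}) − α | ≤ (√(2·log(2/δ))/(1−ε))·T^{−1/2} + (1/η + (1+ε)/(1−ε))·T^{−1}. -/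
open MeasureTheory ProbabilityTheory

/-- The robust pinball subgradient. -/
noncomputable def robustGrad (α ε : ℝ) (K : ℕ) (τ stil : ℝ) (s : Fin K → ℝ) : ℝ :=
  (1 / (1 - ε)) * ((if stil ≤ τ then (1:ℝ) else 0) - (1 - α))
    - (ε / ((K : ℝ) * (1 - ε))) * ∑ y : Fin K, ((if s y ≤ τ then (1:ℝ) else 0) - (1 - α))

lemma two_point_hoeffding (A B p l : ℝ) (hAB : A < B) (hp : p ∈ Set.Icc A B) :
    (B * Real.exp (l * A) - A * Real.exp (l * B)) / (B - A)
      + (Real.exp (l * B) - Real.exp (l * A)) / (B - A) * p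
      ≤ Real.exp (l * p) * Real.exp (((B - A) / 2) ^ 2 * l ^ 2 / 2) := by
  obtain ⟨h1, h2⟩ := hp
  have hBA : 0 < B - A := sub_pos.2 hAB
  have hw0 : 0 ≤ (B - p) / (B - A) := div_nonneg (by linarith) hBA.le
  have hv0 : 0 ≤ (p - A) / (B - A) := div_nonneg (by linarith) hBA.le
  set w := (B - p) / (B - A) with hw
  set v := (p - A) / (B - A) with hv
  have hwv : w + v = 1 := by rw [hw, hv]; field_simp; ring
  have hwp : w * A + v * B = p := by rw [hw, hv]; field_simp; ring
  let ν : Measure ℝ := ENNReal.ofReal w • Measure.dirac A + ENNReal.ofReal v • Measure.dirac B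
  have hint : ∀ f : ℝ → ℝ, ∫ x, f x ∂ν = w * f A + v * f B := by
    intro f
    rw [integral_add_measure, integral_smul_measure, integral_smul_measure, integral_dirac,
      integral_dirac, ENNReal.toReal_ofReal hw0, ENNReal.toReal_ofReal hv0, smul_eq_mul,
      smul_eq_mul]
    · exact (integrable_dirac (by simp)).smul_measure (by simp)
    · exact (integrable_dirac (by simp)).smul_measure (by simp)
  have : IsProbabilityMeasure ν := ⟨by
    simp only [ν, Measure.coe_add, Measure.coe_smul, Pi.add_apply, Pi.smul_apply,
      measure_univ, smul_eq_mul, mul_one]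
    rw [← ENNReal.ofReal_add hw0 hv0, hwv, ENNReal.ofReal_one]⟩
  have hb : ∀ᵐ x ∂ν, (id x : ℝ) ∈ Set.Icc A B := by
    rw [ae_iff]
    have hm : MeasurableSet {a : ℝ | ¬ id a ∈ Set.Icc A B} := by
      have := (measurableSet_Icc (a := A) (b := B)).compl
      exact this
    simp [ν, hAB.le]
  have key := (hasSubgaussianMGF_of_mem_Icc (μ := ν) (X := id) aemeasurable_id hb).mgf_le l
  have hn : ((((‖B - A‖₊ / 2) ^ 2 : NNReal)) : ℝ) = ((B - A) / 2) ^ 2 := by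
    push_cast; rw [Real.norm_of_nonneg hBA.le]
  rw [hn] at key
  simp only [mgf, hint, id] at key
  rw [hwp] at key
  have e1 : Real.exp (l * A) = Real.exp (l * p) * Real.exp (l * (A - p)) := by
    rw [← Real.exp_add]; ring_nf
  have e2 : Real.exp (l * B) = Real.exp (l * p) * Real.exp (l * (B - p)) := by
    rw [← Real.exp_add]; ring_nf
  have e3 : (B * Real.exp (l * A) - A * Real.exp (l * B)) / (B - A)
      + (Real.exp (l * B) - Real.exp (l * A)) / (B - A) * p
      = w * Real.exp (l * A) + v * Real.exp (l * B) := by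
    rw [hw, hv]; field_simp; ring
  rw [e3, e1, e2]
  calc _ = Real.exp (l * p) * (w * Real.exp (l * (A - p)) + v * Real.exp (l * (B - p))) := by ring
    _ ≤ _ := mul_le_mul_of_nonneg_left key (Real.exp_pos _).le

lemma exp_le_chord (A B x l : ℝ) (hAB : A < B) (hx : x ∈ Set.Icc A B) :
    Real.exp (l * x) ≤ (B * Real.exp (l * A) - A * Real.exp (l * B)) / (B - A)
      + (Real.exp (l * B) - Real.exp (l * A)) / (B - A) * x := by
  obtain ⟨h1, h2⟩ := hx
  have hBA : 0 < B - A := sub_pos.2 hAB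
  have hw0 : 0 ≤ (B - x) / (B - A) := div_nonneg (by linarith) hBA.le
  have hv0 : 0 ≤ (x - A) / (B - A) := div_nonneg (by linarith) hBA.le
  have hwv : (B - x) / (B - A) + (x - A) / (B - A) = 1 := by field_simp; ring
  have := convexOn_exp.2 (Set.mem_univ (l * A)) (Set.mem_univ (l * B)) hw0 hv0 hwv
  simp only [smul_eq_mul] at this
  calc _ = Real.exp ((B - x) / (B - A) * (l * A) + (x - A) / (B - A) * (l * B)) := by
        congr 1; field_simp; ring
    _ ≤ _ := this
    _ = _ := by field_simp; ring

lemma integrable_exp_of_ae_bound {Ω : Type*} {m0 : MeasurableSpace Ω} {μ : Measure Ω}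
    [IsProbabilityMeasure μ] {f : Ω → ℝ} (hf : AEStronglyMeasurable f μ) (C : ℝ)
    (hC : ∀ᵐ ω ∂μ, |f ω| ≤ C) (l : ℝ) : Integrable (fun ω => Real.exp (l * f ω)) μ := by
  refine Integrable.of_bound
    (Real.continuous_exp.comp_aestronglyMeasurable (hf.const_mul l)) (Real.exp (|l| * C)) ?_
  filter_upwards [hC] with ω h
  rw [Real.norm_of_nonneg (Real.exp_pos _).le]
  apply Real.exp_le_exp.2
  calc l * f ω ≤ |l * f ω| := le_abs_self _
    _ = |l| * |f ω| := abs_mul _ _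
    _ ≤ _ := by gcongr

lemma azuma_subgaussian {Ω : Type*} {m0 : MeasurableSpace Ω} (μ : Measure Ω)
    [IsProbabilityMeasure μ] (F : Filtration ℕ m0) (X : ℕ → Ω → ℝ) (A B : ℝ) (hAB : A < B)
    (hX : ∀ n, Measurable[F (n + 1)] (X n)) (hb : ∀ n ω, X n ω ∈ Set.Icc A B) (n : ℕ) :
    HasSubgaussianMGF (fun ω => ∑ i ∈ Finset.range n, (X i ω - (μ[X i | F i]) ω))
      (n * (‖B - A‖₊ / 2) ^ 2) μ := by
  have hBA : 0 < B - A := sub_pos.2 hAB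
  have hXi : ∀ i, Integrable (X i) μ := fun i =>
    Integrable.of_mem_Icc A B ((hX i).mono (F.le _) le_rfl).aemeasurable
      (Filter.Eventually.of_forall (hb i))
  have hpb : ∀ i, ∀ᵐ ω ∂μ, (μ[X i | F i]) ω ∈ Set.Icc A B := by
    intro i
    have h1 := condExp_mono (m := F i) (integrable_const A) (hXi i)
      (Filter.Eventually.of_forall fun ω => (hb i ω).1)
    have h2 := condExp_mono (m := F i) (hXi i) (integrable_const B)
      (Filter.Eventually.of_forall fun ω => (hb i ω).2)
    rw [condExp_const (F.le i)] at h1 h2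
    filter_upwards [h1, h2] with ω a b using ⟨a, b⟩
  have hM : ∀ n, StronglyMeasurable[F n]
      (fun ω => ∑ i ∈ Finset.range n, (X i ω - (μ[X i | F i]) ω)) := by
    intro n
    refine Finset.stronglyMeasurable_fun_sum _ fun i hi => ?_
    have hi' : i < n := Finset.mem_range.1 hi
    exact ((hX i).mono (F.mono hi') le_rfl).stronglyMeasurable.sub
      (stronglyMeasurable_condExp.mono (F.mono hi'.le))
  have hMb : ∀ n : ℕ, ∀ᵐ ω ∂μ,
      |∑ i ∈ Finset.range n, (X i ω - (μ[X i | F i]) ω)| ≤ n * (B - A) := by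
    intro n
    filter_upwards [ae_all_iff.2 hpb] with ω h
    refine (Finset.abs_sum_le_sum_abs _ _).trans ?_
    refine (Finset.sum_le_card_nsmul _ _ (B - A) fun i _ => ?_).trans (by simp)
    rw [abs_le]
    constructor <;> linarith [(h i).1, (h i).2, (hb i ω).1, (hb i ω).2]
  refine ⟨fun l => integrable_exp_of_ae_bound ((hM n).mono (F.le n)).aestronglyMeasurable _
    (hMb n) l, fun l => ?_⟩
  have hn : ((((‖B - A‖₊ / 2) ^ 2 : NNReal)) : ℝ) = ((B - A) / 2) ^ 2 := by
    push_cast; rw [Real.norm_of_nonneg hBA.le]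
  rw [NNReal.coe_mul, hn, NNReal.coe_natCast]
  induction n with
  | zero => simp [mgf]
  | succ n ih =>
    simp only [mgf] at ih ⊢
    set M : Ω → ℝ := fun ω => ∑ i ∈ Finset.range n, (X i ω - (μ[X i | F i]) ω) with hMdef
    set p : Ω → ℝ := μ[X n | F n] with hp
    set a := (B * Real.exp (l * A) - A * Real.exp (l * B)) / (B - A)
    set b := (Real.exp (l * B) - Real.exp (l * A)) / (B - A)
    set W : Ω → ℝ := fun ω => Real.exp (l * (M ω - p ω)) with hWdef
    have hMp : StronglyMeasurable[F n] (fun ω => M ω - p ω) :=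
      (hM n).sub stronglyMeasurable_condExp
    have hW : StronglyMeasurable[F n] W :=
      Real.continuous_exp.comp_stronglyMeasurable (hMp.const_mul l)
    have hWint : Integrable W μ := by
      refine integrable_exp_of_ae_bound (hMp.mono (F.le n)).aestronglyMeasurable
        (n * (B - A) + (|A| + |B|)) ?_ l
      filter_upwards [hMb n, hpb n] with ω h1 h2
      refine (abs_sub _ _).trans (add_le_add h1 ?_)
      rw [abs_le]
      constructor
      · linarith [neg_abs_le A, abs_nonneg B, h2.1]
      · linarith [le_abs_self B, abs_nonneg A, h2.2]
    have hXbd : ∀ᵐ ω ∂μ, ‖X n ω‖ ≤ |A| + |B| := Filter.Eventually.of_forall fun ω => by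
      rw [Real.norm_eq_abs, abs_le]
      constructor
      · linarith [neg_abs_le A, abs_nonneg B, (hb n ω).1]
      · linarith [le_abs_self B, abs_nonneg A, (hb n ω).2]
    have hWX : Integrable (fun ω => W ω * X n ω) μ :=
      hWint.mul_bdd (hXi n).aestronglyMeasurable hXbd
    have hpo : μ[(fun ω => W ω * X n ω) | F n] =ᵐ[μ] fun ω => W ω * p ω :=
      condExp_mul_of_stronglyMeasurable_left hW hWX (hXi n)
    have hWp : Integrable (fun ω => W ω * p ω) μ := integrable_condExp.congr hpo
    have hswap : ∫ ω, W ω * X n ω ∂μ = ∫ ω, W ω * p ω ∂μ := by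
      rw [← integral_condExp (F.le n)]
      exact integral_congr_ae hpo
    have hMint : Integrable (fun ω => Real.exp (l * M ω)) μ :=
      integrable_exp_of_ae_bound ((hM n).mono (F.le n)).aestronglyMeasurable _ (hMb n) l
    calc ∫ ω, Real.exp (l * ∑ i ∈ Finset.range (n + 1), (X i ω - (μ[X i | F i]) ω)) ∂μ
        ≤ ∫ ω, (a * W ω + b * (W ω * X n ω)) ∂μ := by
          refine integral_mono (integrable_exp_of_ae_bound
            ((hM (n+1)).mono (F.le (n+1))).aestronglyMeasurable _ (hMb (n+1)) l)
            ((hWint.const_mul a).add (hWX.const_mul b)) fun ω => ?_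
          have h := exp_le_chord A B (X n ω) l hAB (hb n ω)
          have e : Real.exp (l * ∑ i ∈ Finset.range (n + 1), (X i ω - (μ[X i | F i]) ω))
              = W ω * Real.exp (l * X n ω) := by
            rw [hWdef, ← Real.exp_add, Finset.sum_range_succ]
            congr 1
            simp only [hMdef, hp]
            ring
          simp only [e]
          calc _ ≤ W ω * (a + b * X n ω) := mul_le_mul_of_nonneg_left h (Real.exp_pos _).le
            _ = _ := by ring
      _ = ∫ ω, (a * W ω + b * (W ω * p ω)) ∂μ := by
          rw [integral_add (hWint.const_mul a) (hWX.const_mul b),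
            integral_add (hWint.const_mul a) (hWp.const_mul b), integral_const_mul b,
            integral_const_mul b, hswap]
      _ ≤ ∫ ω, Real.exp (l * M ω) * Real.exp (((B - A) / 2) ^ 2 * l ^ 2 / 2) ∂μ := by
          refine integral_mono_ae ((hWint.const_mul a).add (hWp.const_mul b))
            (hMint.mul_const _) ?_
          filter_upwards [hpb n] with ω h
          have h' := two_point_hoeffding A B (p ω) l hAB h
          calc _ = W ω * (a + b * p ω) := by ring
            _ ≤ W ω * (Real.exp (l * p ω) * Real.exp (((B - A) / 2) ^ 2 * l ^ 2 / 2)) :=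
              mul_le_mul_of_nonneg_left h' (Real.exp_pos _).le
            _ = _ := by
              rw [← mul_assoc, hWdef, ← Real.exp_add]; congr 2; ring
      _ = (∫ ω, Real.exp (l * M ω) ∂μ) * Real.exp (((B - A) / 2) ^ 2 * l ^ 2 / 2) :=
          integral_mul_const _ _
      _ ≤ Real.exp (n * ((B - A) / 2) ^ 2 * l ^ 2 / 2)
            * Real.exp (((B - A) / 2) ^ 2 * l ^ 2 / 2) :=
          mul_le_mul_of_nonneg_right ih (Real.exp_pos _).le
      _ = _ := by rw [← Real.exp_add]; congr 1; push_cast; ring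

lemma robustGrad_eq (α ε : ℝ) (hε : ε ∈ Set.Ioo (0:ℝ) 1) (K : ℕ) (hK : 1 ≤ K) (τ st : ℝ)
    (s : Fin K → ℝ) : robustGrad α ε K τ st s =
      (1 / (1 - ε)) * (if st ≤ τ then (1:ℝ) else 0)
        - (ε / ((K : ℝ) * (1 - ε))) * (∑ y : Fin K, (if s y ≤ τ then (1:ℝ) else 0)) - (1 - α) := by
  have h1 : (1 - ε) ≠ 0 := by linarith [hε.2]
  have h2 : (K : ℝ) ≠ 0 := by positivity
  unfold robustGrad
  rw [Finset.sum_sub_distrib]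
  simp only [Finset.sum_const, Finset.card_univ, Fintype.card_fin, nsmul_eq_mul]
  field_simp
  ring

lemma robustGrad_mem (α ε : ℝ) (hε : ε ∈ Set.Ioo (0:ℝ) 1) (K : ℕ) (hK : 1 ≤ K) (τ st : ℝ)
    (s : Fin K → ℝ) : -(ε / (1 - ε)) - (1 - α) ≤ robustGrad α ε K τ st s ∧
      robustGrad α ε K τ st s ≤ 1 / (1 - ε) - (1 - α) := by
  have h1 : 0 < (1 - ε) := by linarith [hε.2]
  have h2 : (0:ℝ) < K := by positivity
  have h3 := hε.1
  rw [robustGrad_eq α ε hε K hK]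
  set q := ∑ y : Fin K, (if s y ≤ τ then (1:ℝ) else 0) with hq
  have hq0 : 0 ≤ q := Finset.sum_nonneg fun y _ => by split_ifs <;> norm_num
  have hq1 : q ≤ K := by
    refine (Finset.sum_le_card_nsmul _ _ (1:ℝ) fun y _ => ?_).trans (by simp)
    split_ifs <;> norm_num
  have e1 : 0 ≤ ε / (K * (1 - ε)) * q := by positivity
  have e2 : ε / (K * (1 - ε)) * q ≤ ε / (1 - ε) := by
    calc ε / (K * (1 - ε)) * q ≤ ε / (K * (1 - ε)) * K := by gcongr
      _ = _ := by field_simp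
  have e3 : 0 < 1 / (1 - ε) := by positivity
  constructor <;> split_ifs <;> nlinarith

lemma condExp_robustGrad {Ω : Type*} {m G m0 : MeasurableSpace Ω} (μ : Measure Ω)
    [IsProbabilityMeasure μ] (hmG : m ≤ G) (hGm : G ≤ m0)
    (K : ℕ) (hK : 1 ≤ K) (ε α : ℝ) (hε : ε ∈ Set.Ioo (0:ℝ) 1)
    (S : Fin K → Ω → ℝ) (Y : Ω → Fin K) (U : Ω → ℝ) (Yb : Ω → Fin K)
    (hSG : ∀ y, Measurable[G] (S y)) (hYG : Measurable[G] Y)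
    (hU : Measurable U) (hYb : Measurable Yb)
    (hUu : Measure.map U μ = volume.restrict (Set.Icc (0:ℝ) 1))
    (hYu : ∀ y : Fin K, μ {ω | Yb ω = y} = (K : ENNReal)⁻¹)
    (hI : iIndep
        ![MeasurableSpace.comap U inferInstance,
          MeasurableSpace.comap Yb inferInstance, G] μ)
    (Yt : Ω → Fin K) (hYt : ∀ ω, Yt ω = if ε ≤ U ω then Y ω else Yb ω)
    (τ : Ω → ℝ) (hτ : Measurable[m] τ) :
    μ[fun ω => robustGrad α ε K (τ ω) (S (Yt ω) ω) (fun y => S y ω) | m]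
      =ᵐ[μ] fun ω => α - (μ[fun ω => if τ ω < S (Y ω) ω then (1:ℝ) else 0 | m]) ω := by
  have hm : m ≤ m0 := hmG.trans hGm
  have hτG : Measurable[G] τ := hτ.mono hmG le_rfl
  -- the events
  set E : Fin K → Set Ω := fun y => {ω | S y ω ≤ τ ω} with hE
  set E0 : Set Ω := {ω | S (Y ω) ω ≤ τ ω} with hE0
  set C : Set Ω := {ω | ε ≤ U ω} with hC
  set D : Fin K → Set Ω := fun y => {ω | Yb ω = y} with hD
  have hEG : ∀ y, MeasurableSet[G] (E y) := fun y =>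
    measurableSet_le (hSG y) hτG
  have hE0G : MeasurableSet[G] E0 := by
    have : E0 = ⋃ y, (Y ⁻¹' {y} ∩ E y) := by
      ext ω; simp [hE0, hE]
    rw [this]
    exact MeasurableSet.iUnion fun y => (hYG (measurableSet_singleton y)).inter (hEG y)
  have hind : ∀ c d e : Set Ω, MeasurableSet[MeasurableSpace.comap U inferInstance] c →
      MeasurableSet[MeasurableSpace.comap Yb inferInstance] d → MeasurableSet[G] e →
      μ.real (c ∩ d ∩ e) = μ.real c * μ.real d * μ.real e := by
    intro c d e hc hd he
    have := hI.meas_iInter (s := ![c, d, e]) (by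
      intro i; fin_cases i
      · exact hc
      · exact hd
      · exact he)
    have h2 : (⋂ i, ![c, d, e] i) = c ∩ d ∩ e := by
      ext ω; simp [Fin.forall_fin_succ, and_assoc]
    rw [h2, Fin.prod_univ_three] at this
    simp only [Measure.real, this, ENNReal.toReal_mul]
    rfl
  have hCm : MeasurableSet[MeasurableSpace.comap U inferInstance] C :=
    ⟨Set.Ici ε, measurableSet_Ici, rfl⟩
  have hDm : ∀ y, MeasurableSet[MeasurableSpace.comap Yb inferInstance] (D y) := fun y =>
    ⟨{y}, measurableSet_singleton y, rfl⟩
  have hC0 : MeasurableSet C := hU measurableSet_Ici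
  have hD0 : ∀ y, MeasurableSet (D y) := fun y => hYb (measurableSet_singleton y)
  have hμC : μ.real C = 1 - ε := by
    have : μ C = ENNReal.ofReal (1 - ε) := by
      have h1 : μ C = Measure.map U μ (Set.Ici ε) := by
        rw [Measure.map_apply hU measurableSet_Ici]; rfl
      rw [h1, hUu, Measure.restrict_apply measurableSet_Ici]
      have : Set.Ici ε ∩ Set.Icc 0 1 = Set.Icc ε 1 := by
        ext x; simp only [Set.mem_inter_iff, Set.mem_Ici, Set.mem_Icc]
        constructor
        · rintro ⟨h, _, h'⟩; exact ⟨h, h'⟩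
        · rintro ⟨h, h'⟩; exact ⟨h, hε.1.le.trans h, h'⟩
      rw [this, Real.volume_Icc]
    rw [Measure.real, this, ENNReal.toReal_ofReal (by linarith [hε.2])]
  have hμCc : μ.real Cᶜ = ε := by
    rw [measureReal_compl hC0, hμC]; simp
  have hμD : ∀ y, μ.real (D y) = (K : ℝ)⁻¹ := fun y => by
    simp only [Measure.real, hD, hYu y, ENNReal.toReal_inv, ENNReal.toReal_natCast]
  -- the indicator representation
  have hrep : (fun ω => robustGrad α ε K (τ ω) (S (Yt ω) ω) (fun y => S y ω)) = fun ω =>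
      (1 / (1 - ε)) * ((C ∩ E0).indicator (1 : Ω → ℝ) ω
          + ∑ y, (Cᶜ ∩ D y ∩ E y).indicator (1 : Ω → ℝ) ω)
        - (ε / ((K : ℝ) * (1 - ε))) * (∑ y, (E y).indicator (1 : Ω → ℝ) ω) - (1 - α) := by
    funext ω
    rw [robustGrad_eq α ε hε K hK]
    congr 2
    · congr 1
      rw [hYt]
      by_cases h : ε ≤ U ω
      · have hc : ω ∈ C := h
        simp [Set.indicator_apply, hc, h, hE0]
      · have hc : ω ∉ C := h
        simp [Set.indicator_apply, hc, h, hE, hD, ite_and]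
  have hone : ∀ B : Set Ω, MeasurableSet B → Integrable (B.indicator (1 : Ω → ℝ)) μ := fun B hB =>
    (integrable_const (1:ℝ)).indicator hB
  have hE' : ∀ y, MeasurableSet (E y) := fun y => hGm _ (hEG y)
  have hE0' : MeasurableSet E0 := hGm _ hE0G
  have hrepl : (fun ω => if τ ω < S (Y ω) ω then (1:ℝ) else 0) = (E0ᶜ).indicator (1 : Ω → ℝ) := by
    funext ω
    simp [Set.indicator_apply, hE0]
  have i1 := hone _ (hC0.inter hE0')
  have i2 := fun y => hone _ ((hC0.compl.inter (hD0 y)).inter (hE' y))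
  have i3 := fun y => hone _ (hE' y)
  have i4 := hone _ hE0'.compl
  have i2s : Integrable (fun ω => ∑ y, (Cᶜ ∩ D y ∩ E y).indicator (1 : Ω → ℝ) ω) μ :=
    integrable_finsetSum _ fun y _ => i2 y
  have i3s : Integrable (fun ω => ∑ y, (E y).indicator (1 : Ω → ℝ) ω) μ :=
    integrable_finsetSum _ fun y _ => i3 y
  have j1 := (i1.add i2s).const_mul (1 / (1 - ε))
  have j2 := i3s.const_mul (ε / ((K : ℝ) * (1 - ε)))
  rw [hrep, hrepl]
  symm
  refine ae_eq_condExp_of_forall_setIntegral_eq hm ((j1.sub j2).sub (integrable_const _))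
    (fun A _ _ => ((integrable_const α).sub integrable_condExp).integrableOn) ?_
    (stronglyMeasurable_const.sub stronglyMeasurable_condExp).aestronglyMeasurable
  intro A hA _
  have hA0 := hm A hA
  have hAG := hmG A hA
  have hsi : ∀ B : Set Ω, MeasurableSet B →
      ∫ ω in A, B.indicator (1 : Ω → ℝ) ω ∂μ = μ.real (B ∩ A) := by
    intro B hB
    rw [integral_indicator_one hB, measureReal_restrict_apply hB]
  rw [integral_sub (integrable_const _) integrable_condExp.integrableOn,
    setIntegral_condExp hm i4 hA, hsi _ hE0'.compl]
  have hL := integral_sub (μ := μ.restrict A) (j1.sub j2).integrableOn (integrable_const (1 - α))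
  have hL2 := integral_sub (μ := μ.restrict A) j1.integrableOn j2.integrableOn
  have hL3 := integral_add (μ := μ.restrict A) i1.integrableOn i2s.integrableOn
  simp only [Pi.sub_apply, Pi.add_apply] at hL hL2 hL3
  rw [hL, hL2, integral_const_mul, integral_const_mul, hL3,
    integral_finsetSum _ (fun y _ => (i2 y).integrableOn),
    integral_finsetSum _ (fun y _ => (i3 y).integrableOn), hsi _ (hC0.inter hE0')]
  simp only [hsi _ (hE' _), hsi _ ((hC0.compl.inter (hD0 _)).inter (hE' _))]
  have k1 : μ.real (C ∩ E0 ∩ A) = (1 - ε) * μ.real (E0 ∩ A) := by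
    have := hind C Set.univ (E0 ∩ A) hCm MeasurableSet.univ (hE0G.inter hAG)
    simp only [Set.inter_univ, probReal_univ, mul_one, hμC] at this
    rw [Set.inter_assoc, this]
  have k2 : ∀ y, μ.real (Cᶜ ∩ D y ∩ E y ∩ A) = ε * (K:ℝ)⁻¹ * μ.real (E y ∩ A) := by
    intro y
    have := hind Cᶜ (D y) (E y ∩ A) hCm.compl (hDm y) ((hEG y).inter hAG)
    rw [Set.inter_assoc, this, hμCc, hμD]
  have k3 : μ.real (E0ᶜ ∩ A) = μ.real A - μ.real (E0 ∩ A) := by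
    have := measureReal_inter_add_sdiff (μ := μ) (s := A) hE0'
    rw [Set.inter_comm E0ᶜ, Set.inter_comm E0, ← this, Set.sdiff_eq]; ring
  simp only [k1, k2, k3, ← Finset.mul_sum, integral_const, smul_eq_mul,
    measureReal_restrict_apply MeasurableSet.univ, Set.univ_inter]
  have h1 : (1 - ε) ≠ 0 := by linarith [hε.2]
  have h2 : (K : ℝ) ≠ 0 := by positivity
  field_simp
  ring

lemma robustGrad_low (α ε : ℝ) (hε : ε ∈ Set.Ioo (0:ℝ) 1) (hα : α ∈ Set.Ioo (0:ℝ) 1)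
    (K : ℕ) (hK : 1 ≤ K) (τ st : ℝ) (s : Fin K → ℝ) (hst : st ∈ Set.Icc (0:ℝ) 1)
    (hs : ∀ y, s y ∈ Set.Icc (0:ℝ) 1) (hτ : τ < 0) : robustGrad α ε K τ st s ≤ 0 := by
  rw [robustGrad_eq α ε hε K hK, if_neg (by linarith [hst.1]),
    Finset.sum_eq_zero fun y _ => if_neg (by linarith [(hs y).1])]
  linarith [hα.2]

lemma robustGrad_high (α ε : ℝ) (hε : ε ∈ Set.Ioo (0:ℝ) 1) (hα : α ∈ Set.Ioo (0:ℝ) 1)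
    (K : ℕ) (hK : 1 ≤ K) (τ st : ℝ) (s : Fin K → ℝ) (hst : st ∈ Set.Icc (0:ℝ) 1)
    (hs : ∀ y, s y ∈ Set.Icc (0:ℝ) 1) (hτ : 1 < τ) : 0 ≤ robustGrad α ε K τ st s := by
  have h1 : (1 - ε) ≠ 0 := by linarith [hε.2]
  have h2 : (K : ℝ) ≠ 0 := by positivity
  rw [robustGrad_eq α ε hε K hK, if_pos (by linarith [hst.2]),
    Finset.sum_congr rfl fun y _ => if_pos (by linarith [(hs y).2])]
  simp only [Finset.sum_const, Finset.card_univ, Fintype.card_fin, nsmul_eq_mul]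
  have : 1 / (1 - ε) * 1 - ε / (K * (1 - ε)) * (K * 1) - (1 - α) = α := by
    field_simp; ring
  rw [this]; exact hα.1.le

lemma measurable_robustGrad {Ω : Type*} {M : MeasurableSpace Ω} (α ε : ℝ) (K : ℕ)
    (S : Fin K → Ω → ℝ) (Yt : Ω → Fin K) (τ : Ω → ℝ) (hS : ∀ y, Measurable (S y))
    (hY : Measurable Yt) (hτ : Measurable τ) :
    Measurable (fun ω => robustGrad α ε K (τ ω) (S (Yt ω) ω) (fun y => S y ω)) := by
  have hE : ∀ y, MeasurableSet {ω | S y ω ≤ τ ω} := fun y => measurableSet_le (hS y) hτ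
  have hE0 : MeasurableSet {ω | S (Yt ω) ω ≤ τ ω} := by
    have : {ω | S (Yt ω) ω ≤ τ ω} = ⋃ y, (Yt ⁻¹' {y} ∩ {ω | S y ω ≤ τ ω}) := by
      ext ω; simp
    rw [this]
    exact MeasurableSet.iUnion fun y => (hY (measurableSet_singleton y)).inter (hE y)
  unfold robustGrad
  refine (((Measurable.ite hE0 measurable_const measurable_const).sub_const _).const_mul _).sub
    (Measurable.const_mul (Finset.measurable_fun_sum _ fun y _ => ?_) _)
  exact (Measurable.ite (hE y) measurable_const measurable_const).sub_const _

/-- expected coverage error bound for NR-OCP (online conformal prediction with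
robust pinball subgradient updates) under uniform label noise, constant learning rate. -/
theorem nrocp_expected_coverage_error_constant_lr
    {Ω : Type*} {m0 : MeasurableSpace Ω} (μ : Measure Ω) [IsProbabilityMeasure μ]
    (F : Filtration ℕ m0)
    (K : ℕ) (hK : 1 ≤ K) (ε α : ℝ) (hε : ε ∈ Set.Ioo (0:ℝ) 1) (hα : α ∈ Set.Ioo (0:ℝ) 1)
    (S : ℕ → Fin K → Ω → ℝ) (Y : ℕ → Ω → Fin K) (U : ℕ → Ω → ℝ) (Ybar : ℕ → Ω → Fin K)
    -- measurability of the scores and labels with respect to the filtration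
    (hS_meas : ∀ t, 1 ≤ t → ∀ y, Measurable[F t] (S t y))
    (hS_range : ∀ t, 1 ≤ t → ∀ y ω, S t y ω ∈ Set.Icc (0:ℝ) 1)
    (hY_meas : ∀ t, 1 ≤ t → Measurable[F t] (Y t))
    (hU_meas : ∀ t, 1 ≤ t → Measurable[F t] (U t))
    (hYbar_meas : ∀ t, 1 ≤ t → Measurable[F t] (Ybar t))
    -- U_t is uniformly distributed on [0,1], Ȳ_t uniformly on {1,…,K}
    (hU_unif : ∀ t, 1 ≤ t → Measure.map (U t) μ = volume.restrict (Set.Icc (0:ℝ) 1))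
    (hYbar_unif : ∀ t, 1 ≤ t → ∀ y : Fin K, μ {ω | Ybar t ω = y} = (K : ENNReal)⁻¹)
    -- U_t, Ȳ_t and the σ-algebra generated by F_{t-1} together with (Y_t, S_{t,·})
    -- are mutually independent
    (hIndep : ∀ t, 1 ≤ t →
      iIndep
        ![MeasurableSpace.comap (U t) inferInstance,
          MeasurableSpace.comap (Ybar t) inferInstance,
          (F (t - 1) : MeasurableSpace Ω) ⊔
            MeasurableSpace.comap (fun ω => (Y t ω, fun y => S t y ω)) inferInstance] μ)
    -- the noisy labels
    (Ytil : ℕ → Ω → Fin K)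
    (hYtil : ∀ t, 1 ≤ t → ∀ ω, Ytil t ω = if ε ≤ U t ω then Y t ω else Ybar t ω)
    -- constant learning rate and deterministic initial threshold
    (η : ℝ) (hη : 0 < η) (τ0 : ℝ) (hτ0 : τ0 ∈ Set.Icc (0:ℝ) 1)
    (τ : ℕ → Ω → ℝ) (hτ1 : ∀ ω, τ 1 ω = τ0)
    -- NR-OCP update using the robust pinball subgradient
    (hupd : ∀ t, 1 ≤ t → ∀ ω,
      τ (t + 1) ω = τ t ω
        - η * robustGrad α ε K (τ t ω) (S t (Ytil t ω) ω) (fun y => S t y ω))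
    (δ : ℝ) (hδ : δ ∈ Set.Ioo (0:ℝ) 1) (T : ℕ) (hT : 1 ≤ T) :
    ENNReal.ofReal (1 - δ) ≤
      μ {ω |
        |(1 / (T : ℝ)) * (∑ t ∈ Finset.Icc 1 T,
              (μ[fun ω' => if τ t ω' < S t (Y t ω') ω' then (1:ℝ) else 0 | F (t - 1)]) ω)
            - α|
          ≤ Real.sqrt (2 * Real.log (2 / δ)) / (1 - ε) / Real.sqrt T
            + (1 / η + (1 + ε) / (1 - ε)) / T} := by
  have hε0 := hε.1
  have hε1 : 0 < 1 - ε := by linarith [hε.2]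
  have hα0 := hα.1
  have hα1 := hα.2
  have hYt_meas : ∀ t, 1 ≤ t → Measurable[F t] (Ytil t) := by
    intro t ht
    have : Ytil t = fun ω => if ε ≤ U t ω then Y t ω else Ybar t ω := funext (hYtil t ht)
    rw [this]
    exact Measurable.ite (m := F t) (p := fun ω => ε ≤ U t ω) (hU_meas t ht measurableSet_Ici)
      (hY_meas t ht) (hYbar_meas t ht)
  have hτ_meas : ∀ n, Measurable[F n] (τ (n + 1)) := by
    intro n
    induction n with
    | zero =>
      have : τ (0 + 1) = fun _ => τ0 := funext hτ1
      rw [this]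
      exact measurable_const
    | succ n ih =>
      have : τ (n + 1 + 1) = fun ω => τ (n + 1) ω - η * robustGrad α ε K (τ (n + 1) ω)
          (S (n + 1) (Ytil (n + 1) ω) ω) (fun y => S (n + 1) y ω) :=
        funext (hupd (n + 1) (by omega))
      rw [this]
      have ih' : Measurable[F (n + 1)] (τ (n + 1)) := ih.mono (F.mono (Nat.le_succ n)) le_rfl
      exact ih'.sub ((measurable_robustGrad (M := F (n + 1)) α ε K (S (n + 1)) (Ytil (n + 1))
        (τ (n + 1)) (hS_meas (n + 1) (by omega)) (hYt_meas (n + 1) (by omega)) ih').const_mul η)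
  let X : ℕ → Ω → ℝ := fun n ω => robustGrad α ε K (τ (n + 1) ω)
    (S (n + 1) (Ytil (n + 1) ω) ω) (fun y => S (n + 1) y ω)
  have hX : ∀ n, Measurable[F (n + 1)] (X n) := fun n =>
    measurable_robustGrad (M := F (n + 1)) α ε K (S (n + 1)) (Ytil (n + 1))
        (τ (n + 1)) (hS_meas (n + 1) (by omega)) (hYt_meas (n + 1) (by omega))
        ((hτ_meas n).mono (F.mono (Nat.le_succ n)) le_rfl)
  have hXb0 : ∀ n ω, -(ε / (1 - ε)) - (1 - α) ≤ X n ω ∧ X n ω ≤ 1 / (1 - ε) - (1 - α) :=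
    fun n ω => robustGrad_mem α ε hε K hK _ _ _
  have hee : ε / (1 - ε) + 1 = 1 / (1 - ε) := by field_simp; ring
  have he0 : 0 < ε / (1 - ε) := by positivity
  set A := -(ε / (1 - ε)) - (1 - α) with hA
  set B := A + 2 / (1 - ε) with hB
  have h2e : 2 / (1 - ε) = 2 * (1 / (1 - ε)) := by ring
  have hAB : A < B := by rw [hB]; linarith
  have hXb : ∀ n ω, X n ω ∈ Set.Icc A B := fun n ω =>
    ⟨(hXb0 n ω).1, (hXb0 n ω).2.trans (by rw [hB, hA]; linarith)⟩
  have hsub := azuma_subgaussian μ F X A B hAB hX hXb T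
  -- conditional expectations
  have hcond : ∀ n, μ[X n | F n] =ᵐ[μ] fun ω => α -
      (μ[fun ω' => if τ (n + 1) ω' < S (n + 1) (Y (n + 1) ω') ω' then (1:ℝ) else 0 | F n]) ω := by
    intro n
    have h1 : 1 ≤ n + 1 := by omega
    have hp : Measurable[(F n : MeasurableSpace Ω) ⊔
        MeasurableSpace.comap (fun ω => (Y (n+1) ω, fun y => S (n+1) y ω)) inferInstance]
        (fun ω => (Y (n+1) ω, fun y => S (n+1) y ω)) :=
      Measurable.mono (comap_measurable _) le_sup_right le_rfl
    refine condExp_robustGrad (m := F n) (G := (F n : MeasurableSpace Ω) ⊔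
        MeasurableSpace.comap (fun ω => (Y (n+1) ω, fun y => S (n+1) y ω)) inferInstance)
      μ le_sup_left (sup_le (F.le n) (Measurable.comap_le ?_)) K hK ε α hε
      (S (n+1)) (Y (n+1)) (U (n+1)) (Ybar (n+1)) ?_ ?_
      ((hU_meas _ h1).mono (F.le _) le_rfl) ((hYbar_meas _ h1).mono (F.le _) le_rfl)
      (hU_unif _ h1) (hYbar_unif _ h1) (hIndep _ h1) (Ytil (n+1)) (hYtil _ h1) (τ (n+1))
      (hτ_meas n)
    · exact ((hY_meas _ h1).mono (F.le _) le_rfl).prodMk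
        (measurable_pi_lambda _ fun y => (hS_meas _ h1 y).mono (F.le _) le_rfl)
    · exact fun y => (measurable_pi_apply y).comp (measurable_snd.comp hp)
    · exact measurable_fst.comp hp
  -- telescoping
  have htel : ∀ n ω, η * ∑ i ∈ Finset.range n, X i ω = τ0 - τ (n + 1) ω := by
    intro n ω
    induction n with
    | zero => simp [hτ1]
    | succ n ih =>
      rw [Finset.sum_range_succ, mul_add, ih, hupd (n + 1) (by omega)]
      ring
  have hrange : ∀ n ω, -(η * (1 / (1 - ε) - (1 - α))) ≤ τ (n + 1) ω ∧
      τ (n + 1) ω ≤ 1 + η * (ε / (1 - ε) + (1 - α)) := by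
    intro n ω
    have q1 : 0 ≤ η * (1 / (1 - ε) - (1 - α)) := mul_nonneg hη.le (by linarith)
    have q2 : 0 ≤ η * (ε / (1 - ε) + (1 - α)) := mul_nonneg hη.le (by linarith)
    induction n with
    | zero => rw [hτ1]; constructor <;> linarith [hτ0.1, hτ0.2]
    | succ n ih =>
      have hr := hS_range (n + 1) (by omega)
      have hu : τ (n + 1 + 1) ω = τ (n + 1) ω - η * X n ω := hupd (n + 1) (by omega) ω
      have b1 : η * X n ω ≤ η * (1 / (1 - ε) - (1 - α)) :=
        mul_le_mul_of_nonneg_left (hXb0 n ω).2 hη.le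
      have b2 : η * A ≤ η * X n ω := mul_le_mul_of_nonneg_left (hXb0 n ω).1 hη.le
      have b3 : η * A = - (η * (ε / (1 - ε) + (1 - α))) := by rw [hA]; ring
      rw [hu]
      constructor
      · rcases lt_or_ge (τ (n + 1) ω) 0 with h | h
        · have := mul_nonpos_of_nonneg_of_nonpos hη.le (robustGrad_low α ε hε hα K hK
            (τ (n + 1) ω) (S (n + 1) (Ytil (n + 1) ω) ω) (fun y => S (n + 1) y ω)
            (hr _ ω) (fun y => hr y ω) h)
          change η * X n ω ≤ 0 at this
          linarith [ih.1]
        · linarith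
      · rcases lt_or_ge 1 (τ (n + 1) ω) with h | h
        · have := mul_nonneg hη.le (robustGrad_high α ε hε hα K hK
            (τ (n + 1) ω) (S (n + 1) (Ytil (n + 1) ω) ω) (fun y => S (n + 1) y ω)
            (hr _ ω) (fun y => hr y ω) h)
          change 0 ≤ η * X n ω at this
          linarith [ih.2]
        · linarith
  have hsum : ∀ ω, |∑ i ∈ Finset.range T, X i ω| ≤ 1 / η + (1 + ε) / (1 - ε) := by
    intro ω
    have h := htel T ω
    have hr := hrange T ω
    have e : η * (1 / η + (1 + ε) / (1 - ε)) = 1 + η * (1 / (1 - ε)) + η * (ε / (1 - ε)) := by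
      field_simp; ring
    have q3 : 0 < η * (ε / (1 - ε)) := by positivity
    have q4 : η * (ε / (1 - ε)) + η = η * (1 / (1 - ε)) := by rw [← hee]; ring
    have q5 : 0 < η * α := by positivity
    have q6 : 0 < η * (1 - α) := mul_pos hη (by linarith)
    have : η * |∑ i ∈ Finset.range T, X i ω| ≤ η * (1 / η + (1 + ε) / (1 - ε)) := by
      rw [← abs_of_pos hη, ← abs_mul, abs_of_pos hη, h, e, abs_le]
      constructor <;> nlinarith [hr.1, hr.2, hτ0.1, hτ0.2]
    exact le_of_mul_le_mul_left this hη
  -- concentration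
  have hT0 : (0:ℝ) < T := by exact_mod_cast hT
  have hδ0 := hδ.1
  have hlog : 0 < Real.log (2 / δ) := Real.log_pos (by rw [lt_div_iff₀ hδ0]; linarith [hδ.2])
  set u : ℝ := Real.sqrt (2 * Real.log (2 / δ)) / (1 - ε) * Real.sqrt T with hu
  have hu0 : 0 ≤ u := by positivity
  have hc : (((T : NNReal) * (‖B - A‖₊ / 2) ^ 2 : NNReal) : ℝ) = T * (1 / (1 - ε)) ^ 2 := by
    have hBA : B - A = 2 / (1 - ε) := by rw [hB]; ring
    push_cast
    rw [hBA, Real.norm_of_nonneg (by positivity)]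
    ring
  have hexp : Real.exp (-u ^ 2 / (2 * (((T : NNReal) * (‖B - A‖₊ / 2) ^ 2 : NNReal) : ℝ)))
      = δ / 2 := by
    have : -u ^ 2 / (2 * (T * (1 / (1 - ε)) ^ 2)) = - Real.log (2 / δ) := by
      rw [hu, mul_pow, div_pow, Real.sq_sqrt (by positivity), Real.sq_sqrt hT0.le]
      field_simp
    rw [hc, this, Real.exp_neg, Real.exp_log (by positivity)]
    field_simp
  have t1 := hsub.measure_ge_le hu0
  have t2 := hsub.neg.measure_ge_le hu0
  rw [hexp] at t1 t2
  set M : Ω → ℝ := fun ω => ∑ i ∈ Finset.range T, (X i ω - (μ[X i | F i]) ω) with hM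
  set good : Set Ω := {ω |
        |(1 / (T : ℝ)) * (∑ t ∈ Finset.Icc 1 T,
              (μ[fun ω' => if τ t ω' < S t (Y t ω') ω' then (1:ℝ) else 0 | F (t - 1)]) ω)
            - α|
          ≤ Real.sqrt (2 * Real.log (2 / δ)) / (1 - ε) / Real.sqrt T
            + (1 / η + (1 + ε) / (1 - ε)) / T} with hgood
  have hcover : ∀ᵐ ω ∂μ, ω ∈ good ∪ ({ω | u ≤ M ω} ∪ {ω | u ≤ (-M) ω}) := by
    filter_upwards [ae_all_iff.2 hcond] with ω hω
    by_cases hbad : ω ∈ ({ω | u ≤ M ω} ∪ {ω | u ≤ (-M) ω})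
    · exact Or.inr hbad
    left
    simp only [Set.mem_union, Set.mem_ofPred_eq, Pi.neg_apply, not_or, not_le] at hbad
    have hMu : |M ω| ≤ u := abs_le.2 ⟨by linarith [hbad.2], hbad.1.le⟩
    have hsumeq : ∑ t ∈ Finset.Icc 1 T,
          (μ[fun ω' => if τ t ω' < S t (Y t ω') ω' then (1:ℝ) else 0 | F (t - 1)]) ω
        = T * α + M ω - ∑ i ∈ Finset.range T, X i ω := by
      have e1 : Finset.Icc 1 T = Finset.Ico 1 (T + 1) := by ext; simp
      rw [e1, Finset.sum_Ico_eq_sum_range]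
      simp only [hM, Finset.sum_sub_distrib, Nat.add_sub_cancel]
      have e2 : ∑ i ∈ Finset.range T, (μ[X i | F i]) ω = T * α - ∑ i ∈ Finset.range T,
          (μ[fun ω' => if τ (1 + i) ω' < S (1 + i) (Y (1 + i) ω') ω' then (1:ℝ) else 0 |
            F (1 + i - 1)]) ω := by
        have : (T : ℝ) * α = ∑ i ∈ Finset.range T, α := by simp
        rw [this, ← Finset.sum_sub_distrib]
        refine Finset.sum_congr rfl fun i _ => ?_
        rw [hω i]
        simp only [add_comm 1 i, Nat.add_sub_cancel]
      rw [e2]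
      ring
    rw [hgood, Set.mem_ofPred_eq]
    rw [hsumeq]
    have e3 : 1 / (T:ℝ) * (T * α + M ω - ∑ i ∈ Finset.range T, X i ω) - α
        = (M ω - ∑ i ∈ Finset.range T, X i ω) / T := by field_simp; ring
    have e4 : Real.sqrt (2 * Real.log (2 / δ)) / (1 - ε) / Real.sqrt T = u / T := by
      rw [hu]
      have hsq : Real.sqrt T * Real.sqrt T = T := Real.mul_self_sqrt hT0.le
      have hs0 : 0 < Real.sqrt T := Real.sqrt_pos.2 hT0
      rw [div_eq_div_iff hs0.ne' hT0.ne', mul_assoc, hsq]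
    rw [e3, e4, ← add_div, abs_div, abs_of_pos hT0]
    gcongr
    exact (abs_sub _ _).trans (add_le_add hMu (hsum ω))
  have hbadm : μ ({ω | u ≤ M ω} ∪ {ω | u ≤ (-M) ω}) ≤ ENNReal.ofReal δ := by
    have s1 : μ {ω | u ≤ M ω} ≤ ENNReal.ofReal (δ / 2) := by
      rw [← ofReal_measureReal]; exact ENNReal.ofReal_le_ofReal t1
    have s2 : μ {ω | u ≤ (-M) ω} ≤ ENNReal.ofReal (δ / 2) := by
      rw [← ofReal_measureReal]; exact ENNReal.ofReal_le_ofReal t2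
    refine (measure_union_le _ _).trans ((add_le_add s1 s2).trans ?_)
    rw [← ENNReal.ofReal_add (by positivity) (by positivity), add_halves]
  have h1 : (1 : ENNReal) ≤ μ good + ENNReal.ofReal δ := by
    calc (1 : ENNReal) = μ (good ∪ ({ω | u ≤ M ω} ∪ {ω | u ≤ (-M) ω})) :=
          by
            have := measure_congr (μ := μ) (Filter.eventuallyEq_univ.2 hcover)
            exact (this.trans measure_univ).symm
      _ ≤ _ := (measure_union_le _ _).trans (by gcongr)
  rw [ENNReal.ofReal_sub _ hδ0.le, ENNReal.ofReal_one]
  exact tsub_le_iff_right.2 h1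
end

section
/- Consider the online uniform label noise model with noise rate ε ∈ (0,1) and α ∈ (0,1). Let (η_t)_{t≥1} be deterministic positive learning rates, set η_0^{−1} := 0, let τ̂_1 ∈ [0,1] be a deterministic initial threshold, and update τ̂_{t+1} = τ̂_t − η_t·g̃(τ̂_t, S̃_t, (S_{t,y})_{y=1}^K). Then for every δ ∈ (0,1) and integer T ≥ 1, with probability at least 1−δ: | (1/T)·Σ_{t=1}^T P(S_t > τ̂_t | F_{t−1}) − α | ≤ (√(2·log(2/δ))/(1−ε))·T^{−1/2} + [ (1 + (max_{1≤t≤T} η_t)·(1+ε)/(1−ε)) · Σ_{t=1}^T |η_t^{−1} − η_{t−1}^{−1}| ]·T^{−1}. -/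
open MeasureTheory ProbabilityTheory

lemma aux_rg {α ε : ℝ} {K : ℕ} (hK : 1 ≤ K) (hε : ε ∈ Set.Ioo (0:ℝ) 1) (τ : ℝ) (s : Fin K → ℝ)
    (hs : ∀ y, s y ∈ Set.Icc (0:ℝ) 1) (z : Fin K) :
    ∃ u p : ℝ, u ∈ Set.Icc (0:ℝ) 1 ∧ p ∈ Set.Icc (0:ℝ) 1 ∧
      robustGrad α ε K τ (s z) s = (u - ε * p) / (1 - ε) - (1 - α) ∧
      (τ < 0 → u = 0 ∧ p = 0) ∧ (1 < τ → u = 1 ∧ p = 1) := by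
  have hKp : (0:ℝ) < K := by exact_mod_cast hK
  have h1 : 0 < 1 - ε := by linarith [hε.2]
  refine ⟨if s z ≤ τ then 1 else 0, (∑ y, if s y ≤ τ then (1:ℝ) else 0) / K, ?_, ?_, ?_, ?_, ?_⟩
  · split_ifs <;> simp
  · constructor
    · refine div_nonneg (Finset.sum_nonneg fun y _ => ?_) hKp.le
      split_ifs <;> simp
    · rw [div_le_one hKp]
      calc _ ≤ ∑ y : Fin K, (1:ℝ) := Finset.sum_le_sum fun y _ => by split_ifs <;> simp
        _ = K := by simp
  · unfold robustGrad
    rw [Finset.sum_sub_distrib]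
    simp only [Finset.sum_const, Finset.card_univ, Fintype.card_fin, nsmul_eq_mul]
    field_simp
    ring
  · intro h
    have : ∀ y, ¬ s y ≤ τ := fun y => by linarith [(hs y).1]
    simp [this]
  · intro h
    have : ∀ y, s y ≤ τ := fun y => by linarith [(hs y).2]
    simp [this, hKp.ne']

lemma aux_det (η τ g : ℕ → ℝ) (hη0 : η 0 = 0) (hη : ∀ t, 1 ≤ t → 0 < η t) (T : ℕ) {A B M : ℝ}
    (hA : 0 ≤ A) (hB : 0 ≤ B) (hM : ∀ t, 1 ≤ t → t ≤ T → η t ≤ M) (hM0 : 0 ≤ M)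
    (h1 : τ 1 ∈ Set.Icc (0:ℝ) 1)
    (hu : ∀ t, 1 ≤ t → τ (t + 1) = τ t - η t * g t)
    (hgA : ∀ t, 1 ≤ t → g t ≤ A) (hgB : ∀ t, 1 ≤ t → -B ≤ g t)
    (hg0 : ∀ t, 1 ≤ t → τ t < 0 → g t ≤ 0) (hg1 : ∀ t, 1 ≤ t → 1 < τ t → 0 ≤ g t) :
    |∑ i ∈ Finset.range T, g (i + 1)|
      ≤ (1 + M * (A + B)) * ∑ i ∈ Finset.range T, |(η (i + 1))⁻¹ - (η i)⁻¹| := by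
  have hb : ∀ n, n ≤ T → τ (n + 1) ∈ Set.Icc (-(M * A)) (1 + M * B) := by
    intro n
    induction n with
    | zero =>
      intro _
      exact ⟨by nlinarith [h1.1], by nlinarith [h1.2]⟩
    | succ n ih =>
      intro hn
      obtain ⟨l, r⟩ := ih (by omega)
      have e := hu (n + 1) (by omega)
      have hp := hη (n + 1) (by omega)
      have hm := hM (n + 1) (by omega) hn
      have ga := hgA (n + 1) (by omega)
      have gb := hgB (n + 1) (by omega)
      have k1 : η (n + 1) * g (n + 1) ≤ M * A :=
        (mul_le_mul_of_nonneg_left ga hp.le).trans (mul_le_mul_of_nonneg_right hm hA)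
      have k2 : -(M * B) ≤ η (n + 1) * g (n + 1) := by
        have := mul_le_mul_of_nonneg_left gb hp.le
        have := mul_le_mul_of_nonneg_right hm hB
        linarith
      rw [e]
      constructor
      · by_cases h : τ (n + 1) < 0
        · have := mul_nonpos_of_nonneg_of_nonpos hp.le (hg0 _ (by omega) h)
          linarith
        · linarith
      · by_cases h : 1 < τ (n + 1)
        · have := mul_nonneg hp.le (hg1 _ (by omega) h)
          linarith
        · linarith
  set c := τ (T + 1) with hc
  have habel : ∀ n, ∑ i ∈ Finset.range n, g (i + 1) =
      (∑ i ∈ Finset.range n, ((η (i + 1))⁻¹ - (η i)⁻¹) * (τ (i + 1) - c))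
        - (η n)⁻¹ * (τ (n + 1) - c) := by
    intro n
    induction n with
    | zero => simp [hη0]
    | succ n ih =>
      rw [Finset.sum_range_succ, Finset.sum_range_succ, ih, hu (n + 1) (by omega)]
      have := (hη (n + 1) (by omega)).ne'
      field_simp
      ring
  rw [habel T, ← hc, sub_self, mul_zero, sub_zero, Finset.mul_sum]
  refine (Finset.abs_sum_le_sum_abs _ _).trans (Finset.sum_le_sum fun i hi => ?_)
  rw [abs_mul, mul_comm]
  refine mul_le_mul_of_nonneg_right ?_ (abs_nonneg _)
  have b1 := hb i (Finset.mem_range.1 hi).le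
  have b2 := hb T le_rfl
  rw [abs_le]
  constructor <;> linarith [b1.1, b1.2, b2.1, b2.2]

lemma aux_cond {Ω : Type*} {m G m0 : MeasurableSpace Ω} {μ : Measure Ω} [IsProbabilityMeasure μ]
    (hm : m ≤ m0) {K : ℕ} (hK : 1 ≤ K) {ε α : ℝ}
    (hε : ε ∈ Set.Ioo (0:ℝ) 1)
    {S : Fin K → Ω → ℝ} {Y Ybar Ytil : Ω → Fin K} {U : Ω → ℝ} {τ : Ω → ℝ}
    (hS : ∀ y, Measurable (S y)) (hY : Measurable Y) (hU : Measurable U) (hYb : Measurable Ybar)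
    (hτ : Measurable[m] τ)
    (hU_unif : Measure.map U μ = volume.restrict (Set.Icc (0:ℝ) 1))
    (hYbar_unif : ∀ y : Fin K, μ {ω | Ybar ω = y} = (K : ENNReal)⁻¹)
    (hIndep : iIndep ![MeasurableSpace.comap U inferInstance,
          MeasurableSpace.comap Ybar inferInstance,
          G] μ)
    (hG : G = m ⊔ MeasurableSpace.comap (fun ω => (Y ω, fun y => S y ω)) inferInstance)
    (hYtil : ∀ ω, Ytil ω = if ε ≤ U ω then Y ω else Ybar ω) :
    μ[fun ω => robustGrad α ε K (τ ω) (S (Ytil ω) ω) (fun y => S y ω) | m]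
      =ᵐ[μ] fun ω => α - (μ[fun ω => if τ ω < S (Y ω) ω then (1:ℝ) else 0 | m]) ω := by
  have hKp : (0:ℝ) < K := by exact_mod_cast hK
  have h1e : 0 < 1 - ε := by linarith [hε.2]
  have hmG : m ≤ G := hG ▸ le_sup_left
  have hpG : Measurable[G] (fun ω => (Y ω, fun y => S y ω)) :=
    Measurable.mono (comap_measurable _) (hG ▸ le_sup_right) le_rfl
  have hYG : Measurable[G] Y := measurable_fst.comp hpG
  have hSG : ∀ y, Measurable[G] (S y) := fun y =>
    (measurable_pi_apply y).comp (measurable_snd.comp hpG)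
  have hGm : G ≤ m0 := hG ▸ sup_le hm
    (Measurable.comap_le (hY.prodMk (measurable_pi_lambda _ hS)))
  have hτG : Measurable[G] τ := hτ.mono hmG le_rfl
  have hSYG : Measurable[G] (fun ω => S (Y ω) ω) := by
    have : Measurable[G] (fun ω => (fun p : Fin K × (Fin K → ℝ) => p.2 p.1)
      (Y ω, fun y => S y ω)) := by
      have h0 : Measurable (fun p : Fin K × (Fin K → ℝ) => p.2 p.1) :=
        measurable_from_prod_countable_right fun y => measurable_pi_apply y
      exact h0.comp hpG
    exact this
  -- basic events
  have hB : ∀ y, MeasurableSet[G] {ω | S y ω ≤ τ ω} := fun y =>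
    measurableSet_le (hSG y) hτG
  have hBY : MeasurableSet[G] {ω | S (Y ω) ω ≤ τ ω} :=
    measurableSet_le hSYG hτG
  have H : ∀ E Z B : Set Ω, MeasurableSet[MeasurableSpace.comap U inferInstance] E →
      MeasurableSet[MeasurableSpace.comap Ybar inferInstance] Z → MeasurableSet[G] B →
      μ.real (E ∩ Z ∩ B) = μ.real E * μ.real Z * μ.real B := by
    intro E Z B h1 h2 h3
    have := hIndep.meas_iInter (s := ![E, Z, B]) (by
      intro i; fin_cases i
      · exact h1
      · exact h2
      · exact h3)
    have e : (⋂ i, (![E, Z, B] : Fin 3 → Set Ω) i) = E ∩ Z ∩ B := by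
      ext ω; simp [Fin.forall_fin_succ, and_assoc]
    rw [e, Fin.prod_univ_three] at this
    simp only [Measure.real, this]
    simp [ENNReal.toReal_mul]
  have hU1 : μ.real {ω | ε ≤ U ω} = 1 - ε := by
    have : μ {ω | ε ≤ U ω} = Measure.map U μ (Set.Ici ε) := by
      rw [Measure.map_apply hU measurableSet_Ici]; rfl
    rw [Measure.real, this, hU_unif, Measure.restrict_apply measurableSet_Ici]
    have e : Set.Ici ε ∩ Set.Icc (0:ℝ) 1 = Set.Icc ε 1 := by
      ext x; simp only [Set.mem_inter_iff, Set.mem_Ici, Set.mem_Icc]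
      constructor
      · rintro ⟨a, b, c⟩; exact ⟨a, c⟩
      · rintro ⟨a, c⟩; exact ⟨a, hε.1.le.trans a, c⟩
    rw [e, Real.volume_Icc, ENNReal.toReal_ofReal h1e.le]
  have hU2 : μ.real {ω | U ω < ε} = ε := by
    have : μ {ω | U ω < ε} = Measure.map U μ (Set.Iio ε) := by
      rw [Measure.map_apply hU measurableSet_Iio]; rfl
    rw [Measure.real, this, hU_unif, Measure.restrict_apply measurableSet_Iio]
    have e : Set.Iio ε ∩ Set.Icc (0:ℝ) 1 = Set.Ico 0 ε := by
      ext x; simp only [Set.mem_inter_iff, Set.mem_Iio, Set.mem_Icc, Set.mem_Ico]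
      constructor
      · rintro ⟨a, b, c⟩; exact ⟨b, a⟩
      · rintro ⟨a, c⟩; exact ⟨c, a, c.le.trans hε.2.le⟩
    rw [e, Real.volume_Ico, sub_zero, ENNReal.toReal_ofReal hε.1.le]
  have hYr : ∀ y, μ.real {ω | Ybar ω = y} = (K:ℝ)⁻¹ := by
    intro y; rw [Measure.real, hYbar_unif y]; simp
  have mE1 : MeasurableSet[MeasurableSpace.comap U inferInstance] {ω | ε ≤ U ω} :=
    ⟨Set.Ici ε, measurableSet_Ici, rfl⟩
  have mE2 : MeasurableSet[MeasurableSpace.comap U inferInstance] {ω | U ω < ε} :=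
    ⟨Set.Iio ε, measurableSet_Iio, rfl⟩
  have mZ : ∀ y, MeasurableSet[MeasurableSpace.comap Ybar inferInstance] {ω | Ybar ω = y} :=
    fun y => ⟨{y}, measurableSet_singleton y, rfl⟩
  have hP1 : ∀ B, MeasurableSet[G] B → μ.real ({ω | ε ≤ U ω} ∩ B) = (1 - ε) * μ.real B := by
    intro B h
    have := H _ Set.univ B mE1 (@MeasurableSet.univ _ _) h
    simpa [hU1] using this
  have hP2 : ∀ y B, MeasurableSet[G] B →
      μ.real ({ω | U ω < ε} ∩ {ω | Ybar ω = y} ∩ B) = ε / K * μ.real B := by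
    intro y B h
    rw [H _ _ B mE2 (mZ y) h, hU2, hYr]; ring
  -- indicator functions
  let I : Set Ω → Ω → ℝ := fun C => C.indicator 1
  have hIi : ∀ C, MeasurableSet C → Integrable (I C) μ := fun C hC =>
    (integrable_const (1:ℝ)).indicator hC
  have hII : ∀ C A, MeasurableSet C → MeasurableSet A → ∫ ω in A, I C ω ∂μ = μ.real (C ∩ A) := by
    intro C A hC hA
    have : ∫ ω in A, I C ω ∂μ = (μ.restrict A).real C := integral_indicator_one hC
    rw [this, measureReal_restrict_apply hC]
  set C1 : Set Ω := {ω | ε ≤ U ω} ∩ {ω | S (Y ω) ω ≤ τ ω} with hC1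
  set C2 : Fin K → Set Ω := fun y =>
    {ω | U ω < ε} ∩ {ω | Ybar ω = y} ∩ {ω | S y ω ≤ τ ω} with hC2
  have mC1 : MeasurableSet C1 := (measurableSet_le measurable_const hU).inter (hGm _ hBY)
  have mC2 : ∀ y, MeasurableSet (C2 y) := fun y =>
    ((measurableSet_lt hU measurable_const).inter (hYb (measurableSet_singleton y))).inter
      (hGm _ (hB y))
  have hX : (fun ω => robustGrad α ε K (τ ω) (S (Ytil ω) ω) (fun y => S y ω)) =
      fun ω => (1 / (1 - ε)) * (I C1 ω + ∑ y, I (C2 y) ω)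
        - (ε / (K * (1 - ε))) * (∑ y, I {ω | S y ω ≤ τ ω} ω) + (α - 1) := by
    funext ω
    have e1 : (if S (Ytil ω) ω ≤ τ ω then (1:ℝ) else 0) = I C1 ω + ∑ y, I (C2 y) ω := by
      by_cases h : ε ≤ U ω
      · have h2 : ∀ y, I (C2 y) ω = 0 := fun y => by
          simp [I, hC2, not_lt.2 h]
        simp [h2, hYtil, h, I, hC1, Set.indicator]
      · have h2 : ∀ y, I (C2 y) ω = if y = Ybar ω then
          (if S (Ybar ω) ω ≤ τ ω then (1:ℝ) else 0) else 0 := fun y => by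
          by_cases hy : y = Ybar ω
          · subst hy; simp [I, hC2, Set.indicator, not_le.1 h]
          · simp [I, hC2, hy, eq_comm]
        simp [h2, hYtil, h, I, hC1, Set.indicator]
    have e2 : ∀ y, (if S y ω ≤ τ ω then (1:ℝ) else 0) = I {ω | S y ω ≤ τ ω} ω := fun y => by
      simp [I, Set.indicator]
    unfold robustGrad
    rw [Finset.sum_sub_distrib, e1]
    simp only [e2, Finset.sum_const, Finset.card_univ, Fintype.card_fin, nsmul_eq_mul]
    field_simp
    ring
  have hf : (fun ω => if τ ω < S (Y ω) ω then (1:ℝ) else 0) =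
      fun ω => 1 - I {ω | S (Y ω) ω ≤ τ ω} ω := by
    funext ω
    by_cases h : S (Y ω) ω ≤ τ ω
    · simp [I, h, not_lt.2 h]
    · simp [I, h, not_le.1 h]
  have hfi : Integrable (fun ω => if τ ω < S (Y ω) ω then (1:ℝ) else 0) μ := by
    rw [hf]; exact (integrable_const 1).sub (hIi _ (hGm _ hBY))
  have i1 : Integrable (fun ω => I C1 ω + ∑ y, I (C2 y) ω) μ :=
    (hIi _ mC1).add (integrable_finsetSum _ fun y _ => hIi _ (mC2 y))
  have i2 : Integrable (fun ω => ∑ y, I {ω | S y ω ≤ τ ω} ω) μ :=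
    integrable_finsetSum _ fun y _ => hIi _ (hGm _ (hB y))
  have hXi : Integrable
      (fun ω => robustGrad α ε K (τ ω) (S (Ytil ω) ω) (fun y => S y ω)) μ := by
    rw [hX]
    exact ((i1.const_mul _).sub (i2.const_mul _)).add (integrable_const _)
  have key : ∀ A, MeasurableSet[m] A →
      ∫ ω in A, robustGrad α ε K (τ ω) (S (Ytil ω) ω) (fun y => S y ω) ∂μ
        = ∫ ω in A, (α - (if τ ω < S (Y ω) ω then (1:ℝ) else 0)) ∂μ := by
    intro A hA
    have hA0 := hm _ hA
    have hAG := hmG _ hA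
    have L : ∫ ω in A, robustGrad α ε K (τ ω) (S (Ytil ω) ω) (fun y => S y ω) ∂μ
        = (1 / (1 - ε)) * (μ.real (C1 ∩ A) + ∑ y, μ.real (C2 y ∩ A))
          - (ε / (K * (1 - ε))) * (∑ y, μ.real ({ω | S y ω ≤ τ ω} ∩ A))
          + (α - 1) * μ.real A := by
      have i12 : Integrable (fun ω => (1 / (1 - ε)) * (I C1 ω + ∑ y, I (C2 y) ω)
          - (ε / (K * (1 - ε))) * (∑ y, I {ω | S y ω ≤ τ ω} ω)) μ :=
        (i1.const_mul _).sub (i2.const_mul _)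
      rw [hX, integral_add i12.integrableOn (integrable_const _), integral_sub (i1.const_mul _).integrableOn
        (i2.const_mul _).integrableOn, integral_const_mul, integral_const_mul,
        integral_add (hIi _ mC1).integrableOn
          (integrable_finsetSum _ fun y _ => hIi _ (mC2 y)).integrableOn,
        integral_finsetSum _ fun y _ => (hIi _ (mC2 y)).integrableOn,
        integral_finsetSum _ fun y _ => (hIi _ (hGm _ (hB y))).integrableOn,
        hII _ _ mC1 hA0, setIntegral_const, smul_eq_mul]
      simp only [hII _ _ (mC2 _) hA0, hII _ _ (hGm _ (hB _)) hA0]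
      ring
    have Rr : ∫ ω in A, (α - (if τ ω < S (Y ω) ω then (1:ℝ) else 0)) ∂μ
        = μ.real ({ω | S (Y ω) ω ≤ τ ω} ∩ A) + (α - 1) * μ.real A := by
      have e : (fun ω => α - (if τ ω < S (Y ω) ω then (1:ℝ) else 0)) =
          fun ω => I {ω | S (Y ω) ω ≤ τ ω} ω + (α - 1) := by
        funext ω
        have := congrFun hf ω
        rw [this]; ring
      rw [e, integral_add (hIi _ (hGm _ hBY)).integrableOn (integrable_const _),
        hII _ _ (hGm _ hBY) hA0, setIntegral_const, smul_eq_mul]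
      ring
    rw [L, Rr, hC1]
    have q1 : ∀ y, μ.real (C2 y ∩ A) = ε / K * μ.real ({ω | S y ω ≤ τ ω} ∩ A) := by
      intro y
      rw [hC2]; simp only
      rw [Set.inter_assoc _ {ω | S y ω ≤ τ ω}, hP2 y _ ((hB y).inter hAG)]
    rw [Set.inter_assoc, hP1 _ (hBY.inter hAG)]
    simp only [q1]
    rw [← Finset.mul_sum]
    field_simp
    ring
  have hgi : Integrable (fun ω => α - (if τ ω < S (Y ω) ω then (1:ℝ) else 0)) μ :=
    (integrable_const α).sub hfi
  have s1 : μ[fun ω => robustGrad α ε K (τ ω) (S (Ytil ω) ω) (fun y => S y ω) | m]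
      =ᵐ[μ] μ[fun ω => α - (if τ ω < S (Y ω) ω then (1:ℝ) else 0) | m] := by
    refine ae_eq_condExp_of_forall_setIntegral_eq hm hgi
      (fun _ _ _ => integrable_condExp.integrableOn) ?_
      stronglyMeasurable_condExp.aestronglyMeasurable
    intro A hA _
    rw [setIntegral_condExp hm hXi hA, key A hA]
  have s2 := condExp_sub (integrable_const (μ := μ) α) hfi m
  rw [condExp_const hm] at s2
  exact s1.trans s2

lemma aux_chord {a b s x : ℝ} (hab : a < b) (hx : x ∈ Set.Icc a b) :
    Real.exp (s * x) ≤ Real.exp (s * a) +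
      (Real.exp (s * b) - Real.exp (s * a)) / (b - a) * (x - a) := by
  have h0 : 0 < b - a := by linarith
  have hp0 : 0 ≤ (b - x) / (b - a) := div_nonneg (by linarith [hx.2]) h0.le
  have hq0 : 0 ≤ (x - a) / (b - a) := div_nonneg (by linarith [hx.1]) h0.le
  have h := convexOn_exp.2 (Set.mem_univ (s * a)) (Set.mem_univ (s * b)) hp0 hq0
    (by field_simp; ring)
  simp only [smul_eq_mul] at h
  have e1 : (b - x) / (b - a) * (s * a) + (x - a) / (b - a) * (s * b) = s * x := by
    field_simp; ring
  rw [e1] at h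
  refine h.trans (le_of_eq ?_)
  field_simp; ring

lemma aux_bern {a b s m : ℝ} (hab : a < b) (hm : m ∈ Set.Icc a b) :
    Real.exp (s * a) + (Real.exp (s * b) - Real.exp (s * a)) / (b - a) * (m - a)
      ≤ Real.exp (s * m + s ^ 2 * ((b - a) / 2) ^ 2 / 2) := by
  have h0 : 0 < b - a := by linarith
  set p : ℝ := (b - m) / (b - a) with hp
  set q : ℝ := (m - a) / (b - a) with hq
  have hp0 : 0 ≤ p := div_nonneg (by linarith [hm.2]) h0.le
  have hq0 : 0 ≤ q := div_nonneg (by linarith [hm.1]) h0.le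
  have hpq : p + q = 1 := by rw [hp, hq]; field_simp; ring
  let ν : Measure ℝ := ENNReal.ofReal p • Measure.dirac a + ENNReal.ofReal q • Measure.dirac b
  have hν : IsProbabilityMeasure ν := ⟨by
    simp only [ν, Measure.add_apply, Measure.smul_apply, measure_univ, smul_eq_mul, mul_one]
    rw [← ENNReal.ofReal_add hp0 hq0, hpq, ENNReal.ofReal_one]⟩
  have hint : ∀ f : ℝ → ℝ, ∫ x, f x ∂ν = p * f a + q * f b := by
    intro f
    have i1 : Integrable f (ENNReal.ofReal p • Measure.dirac a) :=
      (integrable_dirac (by simp)).smul_measure (by simp)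
    have i2 : Integrable f (ENNReal.ofReal q • Measure.dirac b) :=
      (integrable_dirac (by simp)).smul_measure (by simp)
    rw [integral_add_measure i1 i2, integral_smul_measure, integral_smul_measure]
    simp [hp0, hq0]
  have hmean : p * a + q * b = m := by rw [hp, hq]; field_simp; ring
  have hae : ∀ᵐ x ∂ν, id x ∈ Set.Icc a b := by
    simp only [ν, ae_add_measure_iff]
    constructor
    · refine Measure.ae_smul_measure ?_ _
      refine (ae_dirac_iff (p := fun x => id x ∈ Set.Icc a b) measurableSet_Icc).2 ?_; exact ⟨le_rfl, hab.le⟩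
    · refine Measure.ae_smul_measure ?_ _
      refine (ae_dirac_iff (p := fun x => id x ∈ Set.Icc a b) measurableSet_Icc).2 ?_; exact ⟨hab.le, le_rfl⟩
  have H := (hasSubgaussianMGF_of_mem_Icc (μ := ν) aemeasurable_id hae).mgf_le s
  simp only [mgf, id] at H
  rw [hint, hint, hmean] at H
  have e2 : (((‖b - a‖₊ / 2) ^ 2 : NNReal) : ℝ) = ((b - a) / 2) ^ 2 := by
    push_cast; rw [Real.norm_of_nonneg h0.le]
  rw [e2] at H
  calc _ = Real.exp (s * m) * (p * Real.exp (s * (a - m)) + q * Real.exp (s * (b - m))) := by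
        have : Real.exp (s * a) = Real.exp (s * m) * Real.exp (s * (a - m)) := by
          rw [← Real.exp_add]; ring_nf
        have h3 : Real.exp (s * b) = Real.exp (s * m) * Real.exp (s * (b - m)) := by
          rw [← Real.exp_add]; ring_nf
        rw [mul_add, mul_left_comm, ← this, mul_left_comm, ← h3, hp, hq]; field_simp; ring
    _ ≤ _ := by
        rw [Real.exp_add]
        refine mul_le_mul_of_nonneg_left (H.trans (le_of_eq ?_)) (Real.exp_pos _).le
        ring_nf

lemma aux_step {Ω : Type*} {m m0 : MeasurableSpace Ω} {μ : Measure Ω} [IsProbabilityMeasure μ]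
    (hm : m ≤ m0) {V X : Ω → ℝ} (hV : StronglyMeasurable[m] V) (hV0 : ∀ ω, 0 ≤ V ω)
    {C : ℝ} (hVC : ∀ᵐ ω ∂μ, V ω ≤ C) (hX : Measurable X) {a b : ℝ} (hab : a < b)
    (hXr : ∀ ω, X ω ∈ Set.Icc a b) (s : ℝ) :
    ∫ ω, V ω * Real.exp (s * (X ω - (μ[X | m]) ω)) ∂μ
      ≤ Real.exp (s ^ 2 * ((b - a) / 2) ^ 2 / 2) * ∫ ω, V ω ∂μ := by
  have hXi : Integrable X μ := Integrable.of_mem_Icc a b hX.aemeasurable (.of_forall hXr)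
  have hmr : ∀ᵐ ω ∂μ, (μ[X | m]) ω ∈ Set.Icc a b :=
    (convex_Icc a b).condExp_mem hm hXi isClosed_Icc (.of_forall hXr)
  set M : Ω → ℝ := μ[X | m] with hM
  have hMm : StronglyMeasurable[m] M := stronglyMeasurable_condExp
  set B : ℝ := (Real.exp (s * b) - Real.exp (s * a)) / (b - a) with hB
  set A : ℝ := Real.exp (s * a) - B * a with hA
  have hch : ∀ x ∈ Set.Icc a b, Real.exp (s * x) ≤ A + B * x := by
    intro x hx
    have := aux_chord (s := s) hab hx
    rw [← hB] at this; rw [hA]; linarith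
  have hbe : ∀ x ∈ Set.Icc a b, A + B * x ≤ Real.exp (s * x + s ^ 2 * ((b - a) / 2) ^ 2 / 2) := by
    intro x hx
    have := aux_bern (s := s) hab hx
    rw [← hB] at this; rw [hA]; linarith
  set W : Ω → ℝ := fun ω => V ω * Real.exp (-(s * M ω)) with hW
  have hWm : StronglyMeasurable[m] W :=
    hV.mul (Real.continuous_exp.comp_stronglyMeasurable (hMm.const_mul s).neg)
  have hW0 : ∀ ω, 0 ≤ W ω := fun ω => mul_nonneg (hV0 ω) (Real.exp_pos _).le
  have hMab : ∀ᵐ ω ∂μ, |M ω| ≤ max |a| |b| := by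
    filter_upwards [hmr] with ω h
    exact abs_le_max_abs_abs h.1 h.2
  set R : ℝ := max |a| |b|
  have hXR : ∀ ω, |X ω| ≤ R := fun ω => abs_le_max_abs_abs (hXr ω).1 (hXr ω).2
  have hWC : ∀ᵐ ω ∂μ, ‖W ω‖ ≤ |C| * Real.exp (|s| * R) := by
    filter_upwards [hVC, hMab] with ω h1 h2
    rw [Real.norm_of_nonneg (hW0 ω)]
    refine mul_le_mul (h1.trans (le_abs_self _)) (Real.exp_le_exp.2 ?_) (Real.exp_pos _).le
      (abs_nonneg _)
    calc -(s * M ω) ≤ |s * M ω| := neg_le_abs _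
      _ = |s| * |M ω| := abs_mul _ _
      _ ≤ _ := by gcongr
  have hWi : Integrable W μ := .of_bound (hWm.mono hm).aestronglyMeasurable _ hWC
  have hVi : Integrable V μ := by
    refine .of_bound (hV.mono hm).aestronglyMeasurable C ?_
    filter_upwards [hVC] with ω h
    rwa [Real.norm_of_nonneg (hV0 ω)]
  have hWX : Integrable (W * X) μ := by
    refine hXi.bdd_mul (hWm.mono hm).aestronglyMeasurable hWC
  have hWMi : Integrable (W * M) μ := by
    refine integrable_condExp.bdd_mul (hWm.mono hm).aestronglyMeasurable hWC
  have hpull : ∫ ω, W ω * X ω ∂μ = ∫ ω, W ω * M ω ∂μ := by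
    have h1 := condExp_mul_of_stronglyMeasurable_left hWm hWX hXi
    have h2 := integral_condExp (μ := μ) (f := W * X) hm
    rw [integral_congr_ae h1] at h2
    exact h2.symm
  have e0 : ∀ ω, V ω * Real.exp (s * (X ω - M ω)) = W ω * Real.exp (s * X ω) := by
    intro ω; rw [hW]; simp only; rw [mul_assoc, ← Real.exp_add]; ring_nf
  have hE : Integrable (fun ω => Real.exp (s * X ω)) μ :=
    integrable_exp_mul_of_mem_Icc hX.aemeasurable (.of_forall hXr)
  have iL : Integrable (fun ω => W ω * Real.exp (s * X ω)) μ :=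
    hE.bdd_mul (hWm.mono hm).aestronglyMeasurable hWC
  have iX : Integrable (fun ω => A * W ω + B * (W ω * X ω)) μ :=
    (hWi.const_mul A).add (hWX.const_mul B)
  have iM : Integrable (fun ω => A * W ω + B * (W ω * M ω)) μ :=
    (hWi.const_mul A).add (hWMi.const_mul B)
  calc _ = ∫ ω, W ω * Real.exp (s * X ω) ∂μ := integral_congr_ae (.of_forall e0)
    _ ≤ ∫ ω, (A * W ω + B * (W ω * X ω)) ∂μ := by
        refine integral_mono iL iX fun ω => ?_
        have := mul_le_mul_of_nonneg_left (hch _ (hXr ω)) (hW0 ω)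
        simp only
        linarith
    _ = ∫ ω, (A * W ω + B * (W ω * M ω)) ∂μ := by
        have hWX' : Integrable (fun ω => B * (W ω * X ω)) μ := hWX.const_mul B
        have hWM' : Integrable (fun ω => B * (W ω * M ω)) μ := hWMi.const_mul B
        rw [integral_add (hWi.const_mul A) hWX', integral_add (hWi.const_mul A) hWM',
          integral_const_mul B, integral_const_mul B, hpull]
    _ ≤ ∫ ω, Real.exp (s ^ 2 * ((b - a) / 2) ^ 2 / 2) * V ω ∂μ := by
        refine integral_mono_ae iM (hVi.const_mul _) ?_
        filter_upwards [hmr] with ω h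
        have := mul_le_mul_of_nonneg_left (hbe _ h) (hW0 ω)
        have e1 : W ω * Real.exp (s * M ω + s ^ 2 * ((b - a) / 2) ^ 2 / 2)
            = Real.exp (s ^ 2 * ((b - a) / 2) ^ 2 / 2) * V ω := by
          rw [hW]; simp only; rw [mul_assoc, ← Real.exp_add, mul_comm]; ring_nf
        rw [e1] at this
        linarith
    _ = _ := integral_const_mul _ _

lemma aux_azuma_s5 {Ω : Type*} {m0 : MeasurableSpace Ω} {μ : Measure Ω} [IsProbabilityMeasure μ]
    (F : Filtration ℕ m0) (X : ℕ → Ω → ℝ) (hX : ∀ n, Measurable[F (n + 1)] (X n))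
    {a b : ℝ} (hab : a < b) (hXr : ∀ n ω, X n ω ∈ Set.Icc a b) (n : ℕ) :
    HasSubgaussianMGF (fun ω => ∑ i ∈ Finset.range n, (X i ω - (μ[X i | F i]) ω))
      (n * (Real.toNNReal ((b - a) / 2)) ^ 2) μ := by
  have hX0 : ∀ n, Measurable (X n) := fun n => (hX n).mono (F.le _) le_rfl
  have hXi : ∀ n, Integrable (X n) μ := fun n =>
    Integrable.of_mem_Icc a b (hX0 n).aemeasurable (.of_forall (hXr n))
  have hDm : ∀ i, StronglyMeasurable[F (i + 1)] (fun ω => X i ω - (μ[X i | F i]) ω) := fun i =>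
    (hX i).stronglyMeasurable.sub
      (stronglyMeasurable_condExp.mono (F.mono (Nat.le_succ i)))
  have hSm : ∀ n, StronglyMeasurable[F n]
      (fun ω => ∑ i ∈ Finset.range n, (X i ω - (μ[X i | F i]) ω)) := by
    intro n
    refine Finset.stronglyMeasurable_fun_sum _ fun i hi => ?_
    exact (hDm i).mono (F.mono (Finset.mem_range.1 hi))
  have hDb : ∀ i, ∀ᵐ ω ∂μ, |X i ω - (μ[X i | F i]) ω| ≤ b - a := by
    intro i
    filter_upwards [(convex_Icc a b).condExp_mem (F.le i) (hXi i) isClosed_Icc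
      (.of_forall (hXr i))] with ω h
    rw [abs_le]
    constructor <;> linarith [h.1, h.2, (hXr i ω).1, (hXr i ω).2]
  have hSb : ∀ n, ∀ᵐ ω ∂μ,
      |∑ i ∈ Finset.range n, (X i ω - (μ[X i | F i]) ω)| ≤ n * (b - a) := by
    intro n
    filter_upwards [ae_all_iff.2 hDb] with ω h
    calc _ ≤ ∑ i ∈ Finset.range n, |X i ω - (μ[X i | F i]) ω| := Finset.abs_sum_le_sum_abs _ _
      _ ≤ ∑ i ∈ Finset.range n, (b - a) := Finset.sum_le_sum fun i _ => h i
      _ = _ := by simp [mul_sub]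
  have hEb : ∀ (s : ℝ) n, ∀ᵐ ω ∂μ,
      Real.exp (s * ∑ i ∈ Finset.range n, (X i ω - (μ[X i | F i]) ω))
        ≤ Real.exp (|s| * (n * (b - a))) := by
    intro s n
    filter_upwards [hSb n] with ω h
    refine Real.exp_le_exp.2 ((le_abs_self _).trans ?_)
    rw [abs_mul]; gcongr
  have hEm : ∀ (s : ℝ) n, StronglyMeasurable[F n] (fun ω =>
      Real.exp (s * ∑ i ∈ Finset.range n, (X i ω - (μ[X i | F i]) ω))) := fun s n =>
    Real.continuous_exp.comp_stronglyMeasurable ((hSm n).const_mul s)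
  refine ⟨fun s => ?_, fun s => ?_⟩
  · refine .of_bound ((hEm s n).mono (F.le n)).aestronglyMeasurable (Real.exp (|s| * (n * (b - a)))) ?_
    filter_upwards [hEb s n] with ω h
    rwa [Real.norm_of_nonneg (Real.exp_pos _).le]
  · have hc : ((Real.toNNReal ((b - a) / 2) : NNReal) : ℝ) = (b - a) / 2 :=
      Real.coe_toNNReal _ (by linarith)
    push_cast
    rw [hc]
    simp only [mgf]
    induction n with
    | zero => simp
    | succ n ih =>
      have h := aux_step (μ := μ) (F.le n) (hEm s n) (fun ω => (Real.exp_pos _).le) (hEb s n)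
        (hX0 n) hab (hXr n) s
      calc _ = _ := integral_congr_ae (.of_forall fun ω => by
              rw [Finset.sum_range_succ, mul_add, Real.exp_add])
        _ ≤ _ := h
        _ ≤ _ := mul_le_mul_of_nonneg_left ih (Real.exp_pos _).le
        _ = _ := by
          rw [← Real.exp_add]; push_cast; ring_nf

lemma aux_meas {Ω : Type*} {m : MeasurableSpace Ω} {K : ℕ} {ε α : ℝ}
    {S : Fin K → Ω → ℝ} {Z : Ω → Fin K} {τ : Ω → ℝ}
    (hS : ∀ y, Measurable (S y)) (hZ : Measurable Z) (hτ : Measurable τ) :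
    Measurable (fun ω => robustGrad α ε K (τ ω) (S (Z ω) ω) (fun y => S y ω)) := by
  have h0 : Measurable (fun p : Fin K × (Fin K → ℝ) => p.2 p.1) :=
    measurable_from_prod_countable_right fun y => measurable_pi_apply y
  have h1 : Measurable (fun ω => S (Z ω) ω) :=
    h0.comp (hZ.prodMk (measurable_pi_lambda _ hS))
  unfold robustGrad
  have h2 : Measurable (fun ω => if S (Z ω) ω ≤ τ ω then (1:ℝ) else 0) :=
    Measurable.ite (measurableSet_le h1 hτ) measurable_const measurable_const
  have h3 : ∀ y, Measurable (fun ω => if S y ω ≤ τ ω then (1:ℝ) else 0) := fun y =>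
    Measurable.ite (measurableSet_le (hS y) hτ) measurable_const measurable_const
  exact ((h2.sub_const _).const_mul _).sub
    ((Finset.measurable_fun_sum _ fun y _ => (h3 y).sub_const _).const_mul _)

/-- expected coverage error bound for NR-OCP (online conformal prediction with
robust pinball subgradient updates) under uniform label noise, dynamic learning rates. -/
theorem nrocp_expected_coverage_error_dynamic_lr
    {Ω : Type*} {m0 : MeasurableSpace Ω} (μ : Measure Ω) [IsProbabilityMeasure μ]
    (F : Filtration ℕ m0)
    (K : ℕ) (hK : 1 ≤ K) (ε α : ℝ) (hε : ε ∈ Set.Ioo (0:ℝ) 1) (hα : α ∈ Set.Ioo (0:ℝ) 1)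
    (S : ℕ → Fin K → Ω → ℝ) (Y : ℕ → Ω → Fin K) (U : ℕ → Ω → ℝ) (Ybar : ℕ → Ω → Fin K)
    -- measurability of the scores and labels with respect to the filtration
    (hS_meas : ∀ t, 1 ≤ t → ∀ y, Measurable[F t] (S t y))
    (hS_range : ∀ t, 1 ≤ t → ∀ y ω, S t y ω ∈ Set.Icc (0:ℝ) 1)
    (hY_meas : ∀ t, 1 ≤ t → Measurable[F t] (Y t))
    (hU_meas : ∀ t, 1 ≤ t → Measurable[F t] (U t))
    (hYbar_meas : ∀ t, 1 ≤ t → Measurable[F t] (Ybar t))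
    -- U_t is uniformly distributed on [0,1], Ȳ_t uniformly on {1,…,K}
    (hU_unif : ∀ t, 1 ≤ t → Measure.map (U t) μ = volume.restrict (Set.Icc (0:ℝ) 1))
    (hYbar_unif : ∀ t, 1 ≤ t → ∀ y : Fin K, μ {ω | Ybar t ω = y} = (K : ENNReal)⁻¹)
    -- U_t, Ȳ_t and the σ-algebra generated by F_{t-1} together with (Y_t, S_{t,·})
    -- are mutually independent
    (hIndep : ∀ t, 1 ≤ t →
      iIndep
        ![MeasurableSpace.comap (U t) inferInstance,
          MeasurableSpace.comap (Ybar t) inferInstance,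
          (F (t - 1) : MeasurableSpace Ω) ⊔
            MeasurableSpace.comap (fun ω => (Y t ω, fun y => S t y ω)) inferInstance] μ)
    -- the noisy labels
    (Ytil : ℕ → Ω → Fin K)
    (hYtil : ∀ t, 1 ≤ t → ∀ ω, Ytil t ω = if ε ≤ U t ω then Y t ω else Ybar t ω)
    -- dynamic positive learning rates, with the convention η₀⁻¹ = 0 encoded by η 0 = 0
    (η : ℕ → ℝ) (hη : ∀ t, 1 ≤ t → 0 < η t) (hη0 : η 0 = 0)
    (τ0 : ℝ) (hτ0 : τ0 ∈ Set.Icc (0:ℝ) 1)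
    (τ : ℕ → Ω → ℝ) (hτ1 : ∀ ω, τ 1 ω = τ0)
    -- NR-OCP update using the robust pinball subgradient
    (hupd : ∀ t, 1 ≤ t → ∀ ω,
      τ (t + 1) ω = τ t ω
        - η t * robustGrad α ε K (τ t ω) (S t (Ytil t ω) ω) (fun y => S t y ω))
    (δ : ℝ) (hδ : δ ∈ Set.Ioo (0:ℝ) 1) (T : ℕ) (hT : 1 ≤ T) :
    ENNReal.ofReal (1 - δ) ≤
      μ {ω |
        |(1 / (T : ℝ)) * (∑ t ∈ Finset.Icc 1 T,
              (μ[fun ω' => if τ t ω' < S t (Y t ω') ω' then (1:ℝ) else 0 | F (t - 1)]) ω)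
            - α|
          ≤ Real.sqrt (2 * Real.log (2 / δ)) / (1 - ε) / Real.sqrt T
            + ((1 + (⨆ t ∈ Finset.Icc 1 T, η t) * ((1 + ε) / (1 - ε)))
                * ∑ t ∈ Finset.Icc 1 T, |(η t)⁻¹ - (η (t - 1))⁻¹|) / T} := by
  have h1e : 0 < 1 - ε := by linarith [hε.2]
  have hTp : (0:ℝ) < T := by exact_mod_cast hT
  have hYtm : ∀ t, 1 ≤ t → Measurable[F t] (Ytil t) := by
    intro t ht
    have e : Ytil t = fun ω => if ε ≤ U t ω then Y t ω else Ybar t ω := funext (hYtil t ht)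
    rw [e]
    exact Measurable.ite (measurableSet_le measurable_const (hU_meas t ht)) (hY_meas t ht)
      (hYbar_meas t ht)
  set X : ℕ → Ω → ℝ := fun n ω => robustGrad α ε K (τ (n + 1) ω)
    (S (n + 1) (Ytil (n + 1) ω) ω) (fun y => S (n + 1) y ω) with hXdef
  have hτm : ∀ n, Measurable[F n] (τ (n + 1)) := by
    intro n
    induction n with
    | zero =>
      have : τ (0 + 1) = fun _ => τ0 := funext hτ1
      rw [this]; exact measurable_const
    | succ n ih =>
      have e : τ (n + 1 + 1) = fun ω => τ (n + 1) ω - η (n + 1) * X n ω :=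
        funext (hupd (n + 1) (by omega))
      rw [e]
      have ih' : Measurable[F (n + 1)] (τ (n + 1)) := ih.mono (F.mono (Nat.le_succ n)) le_rfl
      exact ih'.sub ((aux_meas (hS_meas (n + 1) (by omega)) (hYtm (n + 1) (by omega))
        ih').const_mul _)
  have hXm : ∀ n, Measurable[F (n + 1)] (X n) := fun n =>
    aux_meas (hS_meas (n + 1) (by omega)) (hYtm (n + 1) (by omega))
      ((hτm n).mono (F.mono (Nat.le_succ n)) le_rfl)
  have hrg := fun n ω => aux_rg (α := α) hK hε (τ (n + 1) ω) (fun y => S (n + 1) y ω)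
    (fun y => hS_range (n + 1) (by omega) y ω) (Ytil (n + 1) ω)
  have hXlo : ∀ n ω, -(ε / (1 - ε) + (1 - α)) ≤ X n ω := by
    intro n ω
    obtain ⟨u, p, hu, hp, e, -, -⟩ := hrg n ω
    have : X n ω = (u - ε * p) / (1 - ε) - (1 - α) := e
    rw [this]
    have : -ε / (1 - ε) ≤ (u - ε * p) / (1 - ε) := by
      gcongr; nlinarith [hu.1, hp.2, hε.1]
    rw [neg_div] at this
    linarith
  have hXhi : ∀ n ω, X n ω ≤ 1 / (1 - ε) - (1 - α) := by
    intro n ω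
    obtain ⟨u, p, hu, hp, e, -, -⟩ := hrg n ω
    have : X n ω = (u - ε * p) / (1 - ε) - (1 - α) := e
    rw [this]
    have : (u - ε * p) / (1 - ε) ≤ 1 / (1 - ε) := by
      gcongr; nlinarith [hu.2, hp.1, hε.1]
    linarith
  have hX0 : ∀ n ω, τ (n + 1) ω < 0 → X n ω ≤ 0 := by
    intro n ω h
    obtain ⟨u, p, hu, hp, e, h0, -⟩ := hrg n ω
    have : X n ω = (u - ε * p) / (1 - ε) - (1 - α) := e
    rw [this, (h0 h).1, (h0 h).2]
    simp; linarith [hα.2]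
  have hX1 : ∀ n ω, 1 < τ (n + 1) ω → 0 ≤ X n ω := by
    intro n ω h
    obtain ⟨u, p, hu, hp, e, -, h0⟩ := hrg n ω
    have : X n ω = (u - ε * p) / (1 - ε) - (1 - α) := e
    rw [this, (h0 h).1, (h0 h).2, mul_one, div_self h1e.ne']
    linarith [hα.1]
  -- the maximal learning rate
  set M : ℝ := ⨆ t ∈ Finset.Icc 1 T, η t with hMdef
  have hM : ∀ t, 1 ≤ t → t ≤ T → η t ≤ M := by
    intro t h1 h2
    have hmem : t ∈ Finset.Icc 1 T := Finset.mem_Icc.2 ⟨h1, h2⟩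
    have hbdd : BddAbove (Set.range fun t => ⨆ _ : t ∈ Finset.Icc 1 T, η t) := by
      refine ⟨∑ i ∈ Finset.Icc 1 T, |η i|, ?_⟩
      rintro _ ⟨i, rfl⟩
      by_cases hi : i ∈ Finset.Icc 1 T
      · simp only [ciSup_pos hi]
        exact (le_abs_self _).trans
          (Finset.single_le_sum (f := fun i => |η i|) (fun _ _ => abs_nonneg _) hi)
      · haveI : IsEmpty (i ∈ Finset.Icc 1 T) := ⟨hi⟩
        simp only [Real.iSup_of_isEmpty]
        exact Finset.sum_nonneg fun _ _ => abs_nonneg _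
    have := le_ciSup hbdd t
    simp only [ciSup_pos hmem] at this
    exact this
  have hM0 : 0 ≤ M := (hη 1 le_rfl).le.trans (hM 1 le_rfl hT)
  -- deterministic bound
  have hdet : ∀ ω, |∑ i ∈ Finset.range T, X i ω| ≤ (1 + M * ((1 + ε) / (1 - ε)))
      * ∑ i ∈ Finset.range T, |(η (i + 1))⁻¹ - (η i)⁻¹| := by
    intro ω
    have hA : 0 ≤ 1 / (1 - ε) - (1 - α) := by
      have : 1 ≤ 1 / (1 - ε) := by rw [le_div_iff₀ h1e]; linarith [hε.1]
      linarith [hα.1]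
    have hB : 0 ≤ ε / (1 - ε) + (1 - α) := by
      have := div_nonneg hε.1.le h1e.le
      linarith [hα.2]
    have h := aux_det η (fun t => τ t ω) (fun t => X (t - 1) ω) hη0 hη T hA hB hM hM0
      (by simpa only [hτ1 ω] using hτ0)
      (by
        intro t ht
        obtain ⟨n, rfl⟩ : ∃ n, t = n + 1 := ⟨t - 1, by omega⟩
        exact hupd (n + 1) ht ω)
      (fun t _ => hXhi _ ω) (fun t _ => hXlo _ ω)
      (by
        intro t ht
        obtain ⟨n, rfl⟩ : ∃ n, t = n + 1 := ⟨t - 1, by omega⟩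
        exact hX0 n ω)
      (by
        intro t ht
        obtain ⟨n, rfl⟩ : ∃ n, t = n + 1 := ⟨t - 1, by omega⟩
        exact hX1 n ω)
    have e : 1 / (1 - ε) - (1 - α) + (ε / (1 - ε) + (1 - α)) = (1 + ε) / (1 - ε) := by
      field_simp; ring
    rw [e] at h
    simpa using h
  -- conditional expectations
  have hcond : ∀ n, μ[X n | F n] =ᵐ[μ] fun ω => α -
      (μ[fun ω' => if τ (n + 1) ω' < S (n + 1) (Y (n + 1) ω') ω' then (1:ℝ) else 0 | F n]) ω := by
    intro n
    have h1 : 1 ≤ n + 1 := by omega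
    exact aux_cond (F.le n) hK hε (fun y => (hS_meas _ h1 y).mono (F.le _) le_rfl)
      ((hY_meas _ h1).mono (F.le _) le_rfl) ((hU_meas _ h1).mono (F.le _) le_rfl)
      ((hYbar_meas _ h1).mono (F.le _) le_rfl) (hτm n) (hU_unif _ h1) (hYbar_unif _ h1)
      (hIndep _ h1) rfl (hYtil _ h1)
  -- concentration
  set D : Ω → ℝ := fun ω => ∑ i ∈ Finset.range T, (X i ω - (μ[X i | F i]) ω) with hD
  set a : ℝ := -(ε / (1 - ε) + (1 - α)) with ha
  have hab : a < a + 2 / (1 - ε) := by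
    have : 0 < 2 / (1 - ε) := by positivity
    linarith
  have haz : HasSubgaussianMGF D
      (T * (Real.toNNReal ((a + 2 / (1 - ε) - a) / 2)) ^ 2) μ := by
    refine aux_azuma_s5 F X hXm hab (fun n ω => ⟨hXlo n ω, (hXhi n ω).trans ?_⟩) T
    have : (1 + ε) / (1 - ε) ≤ 2 / (1 - ε) := by gcongr; linarith [hε.2]
    have e : 1 / (1 - ε) - (1 - α) + (ε / (1 - ε) + (1 - α)) = (1 + ε) / (1 - ε) := by
      field_simp; ring
    rw [ha]; linarith
  have hDm : Measurable D := by
    refine Finset.measurable_fun_sum _ fun i _ => ?_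
    exact ((hXm i).mono (F.le _) le_rfl).sub
      (stronglyMeasurable_condExp.mono (F.le i)).measurable
  set L : ℝ := Real.log (2 / δ) with hL
  have hL0 : 0 ≤ L := Real.log_nonneg (by rw [le_div_iff₀ hδ.1]; linarith [hδ.2])
  set lam : ℝ := Real.sqrt (2 * L) / (1 - ε) * Real.sqrt T with hlam
  have hlam0 : 0 ≤ lam := by positivity
  have hexp : Real.exp (-lam ^ 2 /
      (2 * ((T * (Real.toNNReal ((a + 2 / (1 - ε) - a) / 2)) ^ 2 : NNReal) : ℝ))) = δ / 2 := by
    have e1 : (a + 2 / (1 - ε) - a) / 2 = 1 / (1 - ε) := by ring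
    have e2 : lam ^ 2 = 2 * L / (1 - ε) ^ 2 * T := by
      rw [hlam, mul_pow, div_pow, Real.sq_sqrt (by positivity), Real.sq_sqrt hTp.le]
    push_cast
    rw [e1, Real.coe_toNNReal _ (by positivity), e2]
    have e3 : -(2 * L / (1 - ε) ^ 2 * T) / (2 * (T * (1 / (1 - ε)) ^ 2)) = -L := by
      field_simp
    rw [e3, Real.exp_neg, hL, Real.exp_log (by have := hδ.1; positivity), inv_div]
  have t1 := haz.measure_ge_le hlam0
  have t2 := haz.neg.measure_ge_le hlam0
  rw [hexp] at t1 t2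
  set bad : Set Ω := {ω | lam ≤ D ω} ∪ {ω | lam ≤ (-D) ω} with hbad
  have mbad : MeasurableSet bad :=
    (measurableSet_le measurable_const hDm).union (measurableSet_le measurable_const hDm.neg)
  have hbadle : μ.real bad ≤ δ := (measureReal_union_le _ _).trans (by linarith)
  have hgood : ENNReal.ofReal (1 - δ) ≤ μ badᶜ := by
    rw [← ofReal_measureReal]
    refine ENNReal.ofReal_le_ofReal ?_
    rw [probReal_compl_eq_one_sub mbad]
    linarith
  refine hgood.trans (measure_mono_ae ?_)
  filter_upwards [ae_all_iff.2 hcond] with ω hω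
  intro hb
  have hb1 : D ω < lam := by
    by_contra h; exact hb (Or.inl (not_lt.1 h))
  have hb2 : -D ω < lam := by
    by_contra h; exact hb (Or.inr (not_lt.1 h))
  have r : ∀ f : ℕ → ℝ, ∑ t ∈ Finset.Icc 1 T, f t = ∑ i ∈ Finset.range T, f (i + 1) := by
    intro f
    rw [Finset.range_eq_Ico, Finset.sum_Ico_add' f 0 T 1]
    rfl
  change |_| ≤ _
  rw [r, r]
  simp only [Nat.add_sub_cancel]
  have e1 : ∑ i ∈ Finset.range T,
      (μ[fun ω' => if τ (i + 1) ω' < S (i + 1) (Y (i + 1) ω') ω' then (1:ℝ) else 0 | F i]) ω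
      = T * α - (∑ i ∈ Finset.range T, X i ω - D ω) := by
    have : D ω = ∑ i ∈ Finset.range T, X i ω - ∑ i ∈ Finset.range T, (μ[X i | F i]) ω := by
      rw [hD]; exact Finset.sum_sub_distrib _ _
    rw [this]
    simp only [hω, Finset.sum_sub_distrib, Finset.sum_const, Finset.card_range, nsmul_eq_mul]
    ring
  rw [e1]
  have e2 : 1 / (T:ℝ) * (T * α - (∑ i ∈ Finset.range T, X i ω - D ω)) - α
      = (D ω - ∑ i ∈ Finset.range T, X i ω) / T := by
    field_simp; ring
  have e3 : Real.sqrt (2 * L) / (1 - ε) / Real.sqrt T = lam / T := by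
    rw [hlam, div_eq_div_iff (by positivity) (by positivity)]
    rw [mul_assoc, Real.mul_self_sqrt hTp.le]
  rw [e2, e3, ← add_div, abs_div, abs_of_pos hTp]
  gcongr
  refine (abs_sub _ _).trans (add_le_add ?_ (hdet ω))
  exact abs_le.2 ⟨by linarith, hb1.le⟩
end
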